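/- Existence, uniqueness and uniform bound for the discounted state-constraint problem: let f ∈ C(Ω̄) and m > 2. For every 0 < λ < 1 there exists a unique continuous viscosity solution u_λ of the state-constraint problem −Δu_λ + |Du_λ|^m + λu_λ = f in Ω, −Δu_λ + |Du_λ|^m + λu_λ ≥ f on ∂Ω. Moreover, there exists a constant C₁ > 0 such that |λ·u_λ(x)| ≤ C₁ for all x ∈ Ω̄ and all 0 < λ < 1. -/

import Mathlib

open Set Filter Topology Metric MeasureTheory

noncomputable section

/-- Euclidean space `ℝ^N`. -/
abbrev Euc (N : ℕ) : Type := EuclideanSpace ℝ (Fin N)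

/-- The Laplacian of `φ` at `x`, computed as the trace of the second derivative
in the standard orthonormal basis of `ℝ^N`. -/
noncomputable def lapl {N : ℕ} (φ : Euc N → ℝ) (x : Euc N) : ℝ :=
  ∑ i : Fin N,
    iteratedFDeriv ℝ 2 φ x ![EuclideanSpace.single i 1, EuclideanSpace.single i 1]

/-- `Ω` is a domain with `C²` boundary: it is the sublevel set of a `C²`
defining function whose gradient does not vanish on the boundary. -/
def HasC2Boundary {N : ℕ} (Ω : Set (Euc N)) : Prop :=
  ∃ ρ : Euc N → ℝ, ContDiff ℝ 2 ρ ∧ Ω = {x | ρ x < 0} ∧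
    frontier Ω = {x | ρ x = 0} ∧ ∀ x ∈ frontier Ω, gradient ρ x ≠ 0

/-- The stationary operator `−Δφ(x) + |Dφ(x)|^m + λ r − h(x)` evaluated with the
value `r` of the (sub/super)solution at `x`. -/
noncomputable def statOp {N : ℕ} (h : Euc N → ℝ) (lam m : ℝ)
    (φ : Euc N → ℝ) (r : ℝ) (x : Euc N) : ℝ :=
  -lapl φ x + ‖gradient φ x‖ ^ m + lam * r - h x

/-- Viscosity subsolution of the generalized Dirichlet problem
`S(Ω,h,k,λ)`: `−Δw + |Dw|^m + λ w = h` in `Ω`, `w = k` on `∂Ω`. -/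
def IsStatSub {N : ℕ} (Ω : Set (Euc N)) (h k : Euc N → ℝ) (lam m : ℝ)
    (u : Euc N → ℝ) : Prop :=
  UpperSemicontinuousOn u (closure Ω) ∧
  ∀ φ : Euc N → ℝ, ContDiff ℝ 2 φ → ∀ x₀ ∈ closure Ω,
    IsLocalMaxOn (u - φ) (closure Ω) x₀ →
      (x₀ ∈ Ω → statOp h lam m φ (u x₀) x₀ ≤ 0) ∧
      (x₀ ∈ frontier Ω → min (statOp h lam m φ (u x₀) x₀) (u x₀ - k x₀) ≤ 0)

/-- Viscosity supersolution of the generalized Dirichlet problem `S(Ω,h,k,λ)`. -/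
def IsStatSuper {N : ℕ} (Ω : Set (Euc N)) (h k : Euc N → ℝ) (lam m : ℝ)
    (v : Euc N → ℝ) : Prop :=
  LowerSemicontinuousOn v (closure Ω) ∧
  ∀ φ : Euc N → ℝ, ContDiff ℝ 2 φ → ∀ x₀ ∈ closure Ω,
    IsLocalMinOn (v - φ) (closure Ω) x₀ →
      (x₀ ∈ Ω → 0 ≤ statOp h lam m φ (v x₀) x₀) ∧
      (x₀ ∈ frontier Ω → 0 ≤ max (statOp h lam m φ (v x₀) x₀) (v x₀ - k x₀))

/-- The parabolic operator
`φ_t(x,t) − Δφ(·,t)(x) + |Dφ(·,t)(x)|^m + λ r − f(x)`. -/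
noncomputable def parOp {N : ℕ} (f : Euc N → ℝ) (lam m : ℝ)
    (φ : Euc N × ℝ → ℝ) (r : ℝ) (x : Euc N) (t : ℝ) : ℝ :=
  deriv (fun s => φ (x, s)) t - lapl (fun y => φ (y, t)) x
    + ‖gradient (fun y => φ (y, t)) x‖ ^ m + lam * r - f x

/-- Viscosity subsolution of the generalized initial-boundary value problem
`E(Ω,f,g,u₀,λ)` on the time interval `[0,T]`:
`u_t − Δu + |Du|^m + λ u = f` in `Ω × (0,T]`, `u = g` on `∂Ω × (0,T]`,
`u(·,0) = u₀` on `closure Ω`. -/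
def IsParSub {N : ℕ} (Ω : Set (Euc N)) (f g u₀ : Euc N → ℝ) (lam m T : ℝ)
    (u : Euc N → ℝ → ℝ) : Prop :=
  UpperSemicontinuousOn (fun p : Euc N × ℝ => u p.1 p.2) (closure Ω ×ˢ Ico 0 T) ∧
  (∀ x ∈ closure Ω, u x 0 ≤ u₀ x) ∧
  ∀ φ : Euc N × ℝ → ℝ, ContDiff ℝ 2 φ → ∀ x₀ : Euc N, ∀ t₀ : ℝ,
    (x₀, t₀) ∈ closure Ω ×ˢ Ioc 0 T →
    IsLocalMaxOn (fun p : Euc N × ℝ => u p.1 p.2 - φ p) (closure Ω ×ˢ Ioc 0 T) (x₀, t₀) →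
      (x₀ ∈ Ω → parOp f lam m φ (u x₀ t₀) x₀ t₀ ≤ 0) ∧
      (x₀ ∈ frontier Ω →
        min (parOp f lam m φ (u x₀ t₀) x₀ t₀) (u x₀ t₀ - g x₀) ≤ 0)

/-- Viscosity supersolution of `E(Ω,f,g,u₀,λ)` on the time interval `[0,T]`. -/
def IsParSuper {N : ℕ} (Ω : Set (Euc N)) (f g u₀ : Euc N → ℝ) (lam m T : ℝ)
    (v : Euc N → ℝ → ℝ) : Prop :=
  LowerSemicontinuousOn (fun p : Euc N × ℝ => v p.1 p.2) (closure Ω ×ˢ Icc 0 T) ∧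
  (∀ x ∈ closure Ω, u₀ x ≤ v x 0) ∧
  ∀ φ : Euc N × ℝ → ℝ, ContDiff ℝ 2 φ → ∀ x₀ : Euc N, ∀ t₀ : ℝ,
    (x₀, t₀) ∈ closure Ω ×ˢ Ioc 0 T →
    IsLocalMinOn (fun p : Euc N × ℝ => v p.1 p.2 - φ p) (closure Ω ×ˢ Ioc 0 T) (x₀, t₀) →
      (x₀ ∈ Ω → 0 ≤ parOp f lam m φ (v x₀ t₀) x₀ t₀) ∧
      (x₀ ∈ frontier Ω →
        0 ≤ max (parOp f lam m φ (v x₀ t₀) x₀ t₀) (v x₀ t₀ - g x₀))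

/-- A continuous viscosity solution, global in time, of `E(Ω,f,g,u₀,λ)`. -/
def IsGlobalParSol {N : ℕ} (Ω : Set (Euc N)) (f g u₀ : Euc N → ℝ) (lam m : ℝ)
    (u : Euc N → ℝ → ℝ) : Prop :=
  ContinuousOn (fun p : Euc N × ℝ => u p.1 p.2) (closure Ω ×ˢ Ici 0) ∧
  ∀ T > (0 : ℝ), IsParSub Ω f g u₀ lam m T u ∧ IsParSuper Ω f g u₀ lam m T u

open scoped Classical in
/-- Redefinition of a parabolic subsolution on the lateral boundary by its
`limsup` from inside `Ω × (0,T]`. -/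
noncomputable def uscExtPar {N : ℕ} (Ω : Set (Euc N)) (T : ℝ)
    (u : Euc N → ℝ → ℝ) : Euc N → ℝ → ℝ :=
  fun z t => if z ∈ Ω then u z t
    else limsup (fun p : Euc N × ℝ => u p.1 p.2) (𝓝[Ω ×ˢ Ioc 0 T] (z, t))

open scoped Classical in
/-- Redefinition of a stationary subsolution on the boundary by its `limsup`
from inside `Ω`. -/
noncomputable def uscExtStat {N : ℕ} (Ω : Set (Euc N))
    (u : Euc N → ℝ) : Euc N → ℝ :=
  fun z => if z ∈ Ω then u z else limsup u (𝓝[Ω] z)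

/-- Continuous viscosity solution of the state constraint problem
`−Δw + |Dw|^m + λ w = h` in `Ω`, `−Δw + |Dw|^m + λ w ≥ h` on `∂Ω`. -/
def IsSCSolution {N : ℕ} (Ω : Set (Euc N)) (h : Euc N → ℝ) (lam m : ℝ)
    (w : Euc N → ℝ) : Prop :=
  ContinuousOn w (closure Ω) ∧
  (∀ φ : Euc N → ℝ, ContDiff ℝ 2 φ → ∀ x₀ ∈ Ω, IsLocalMaxOn (w - φ) Ω x₀ →
      statOp h lam m φ (w x₀) x₀ ≤ 0) ∧
  (∀ φ : Euc N → ℝ, ContDiff ℝ 2 φ → ∀ x₀ ∈ closure Ω,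
      IsLocalMinOn (w - φ) (closure Ω) x₀ → 0 ≤ statOp h lam m φ (w x₀) x₀)

/-- Continuous viscosity subsolution of `−Δu + |Du|^m ≤ h` in `Ω`
(no boundary condition). -/
def IsIntSub {N : ℕ} (Ω : Set (Euc N)) (h : Euc N → ℝ) (m : ℝ)
    (u : Euc N → ℝ) : Prop :=
  ∀ φ : Euc N → ℝ, ContDiff ℝ 2 φ → ∀ x₀ ∈ Ω, IsLocalMaxOn (u - φ) Ω x₀ →
    statOp h 0 m φ (u x₀) x₀ ≤ 0

/-- Hölder continuity with exponent `α` on a set. -/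
def HolderOnCl {N : ℕ} (α : ℝ) (s : Set (Euc N)) (w : Euc N → ℝ) : Prop :=
  ∃ C > (0 : ℝ), ∀ x ∈ s, ∀ y ∈ s, |w x - w y| ≤ C * ‖x - y‖ ^ α

/-- Local Lipschitz continuity inside `Ω`. -/
def LocLipIn {N : ℕ} (Ω : Set (Euc N)) (w : Euc N → ℝ) : Prop :=
  ∀ x ∈ Ω, ∃ ε > (0 : ℝ), ∃ K : ℝ, 0 ≤ K ∧
    ∀ y ∈ ball x ε ∩ Ω, ∀ z ∈ ball x ε ∩ Ω, |w y - w z| ≤ K * ‖y - z‖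

/-- A piecewise `C¹` path parametrized on `[0,1]`. -/
def IsPWC1Path {N : ℕ} (γ : ℝ → Euc N) : Prop :=
  ContinuousOn γ (Icc 0 1) ∧
  ∃ n : ℕ, ∃ τ : Fin (n + 1) → ℝ, StrictMono τ ∧ τ 0 = 0 ∧ τ (Fin.last n) = 1 ∧
    ∀ i : Fin n, ContDiffOn ℝ 1 γ (Icc (τ i.castSucc) (τ i.succ))

/-- The length of a path on `[0,1]`. -/
noncomputable def pathLen {N : ℕ} (γ : ℝ → Euc N) : ℝ :=
  ∫ t in (0 : ℝ)..1, ‖derivWithin γ (Icc (0 : ℝ) 1) t‖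

/-- The geodesic-type distance inside `closure S` via piecewise `C¹` paths. -/
noncomputable def dTilde {N : ℕ} (S : Set (Euc N)) (x y : Euc N) : ℝ :=
  sInf {L : ℝ | ∃ γ : ℝ → Euc N, IsPWC1Path γ ∧ γ 0 = x ∧ γ 1 = y ∧
    MapsTo γ (Icc 0 1) (closure S) ∧ L = pathLen γ}

/-- The inner parallel set `Ω_δ = {x ∈ Ω : dist(x,∂Ω) > δ}`. -/
def innerSet {N : ℕ} (Ω : Set (Euc N)) (δ : ℝ) : Set (Euc N) :=
  {x ∈ Ω | δ < infDist x (frontier Ω)}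

end

namespace SC

theorem lapl_eq_sum {N : ℕ} (φ : Euc N → ℝ) (x : Euc N) :
    lapl φ x = ∑ i : Fin N, fderiv ℝ (fderiv ℝ φ) x (EuclideanSpace.single i 1)
      (EuclideanSpace.single i 1) := by
  unfold lapl
  refine Finset.sum_congr rfl fun i _ => ?_
  rw [iteratedFDeriv_two_apply]
  simp

open scoped Laplacian in
theorem lapl_eq_laplacian {N : ℕ} (φ : Euc N → ℝ) (x : Euc N) :
    lapl φ x = (Δ φ) x := by
  rw [InnerProductSpace.laplacian_eq_iteratedFDeriv_orthonormalBasis φ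
    (EuclideanSpace.basisFun (Fin N) ℝ)]
  simp [lapl]

theorem lapl_congr {N : ℕ} {φ ψ : Euc N → ℝ} {x : Euc N} (h : φ =ᶠ[𝓝 x] ψ) :
    lapl φ x = lapl ψ x := by
  rw [lapl_eq_laplacian, lapl_eq_laplacian]
  exact (InnerProductSpace.laplacian_congr_nhds h).self_of_nhds

theorem gradient_congr {N : ℕ} {φ ψ : Euc N → ℝ} {x : Euc N} (h : φ =ᶠ[𝓝 x] ψ) :
    gradient φ x = gradient ψ x := by
  unfold gradient
  rw [h.fderiv_eq]

theorem lapl_add {N : ℕ} {φ ψ : Euc N → ℝ} {x : Euc N} (h1 : ContDiffAt ℝ 2 φ x)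
    (h2 : ContDiffAt ℝ 2 ψ x) : lapl (fun y => φ y + ψ y) x = lapl φ x + lapl ψ x := by
  simp only [lapl_eq_laplacian]
  exact h1.laplacian_add h2

theorem lapl_sub {N : ℕ} {φ ψ : Euc N → ℝ} {x : Euc N} (h1 : ContDiffAt ℝ 2 φ x)
    (h2 : ContDiffAt ℝ 2 ψ x) : lapl (fun y => φ y - ψ y) x = lapl φ x - lapl ψ x := by
  simp only [lapl_eq_laplacian]
  exact h1.laplacian_sub h2

theorem lapl_const_mul {N : ℕ} {φ : Euc N → ℝ} {x : Euc N} (c : ℝ) (h1 : ContDiffAt ℝ 2 φ x) :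
    lapl (fun y => c * φ y) x = c * lapl φ x := by
  simp only [lapl_eq_laplacian]
  exact InnerProductSpace.laplacian_smul c h1

theorem lapl_const {N : ℕ} (c : ℝ) (x : Euc N) : lapl (fun _ => c) x = 0 := by
  simp [lapl_eq_sum]

theorem inner_gradient {N : ℕ} (φ : Euc N → ℝ) (x v : Euc N) :
    inner ℝ (gradient φ x) v = fderiv ℝ φ x v := by
  simp [gradient]

theorem norm_gradient_sq {N : ℕ} (φ : Euc N → ℝ) (x : Euc N) :
    ‖gradient φ x‖ ^ 2 = ∑ i : Fin N, (fderiv ℝ φ x (EuclideanSpace.single i 1)) ^ 2 := by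
  rw [EuclideanSpace.norm_sq_eq]
  refine Finset.sum_congr rfl fun i _ => ?_
  rw [← inner_gradient, EuclideanSpace.inner_single_right]
  simp

theorem gradient_add {N : ℕ} {φ ψ : Euc N → ℝ} {x : Euc N} (h1 : DifferentiableAt ℝ φ x)
    (h2 : DifferentiableAt ℝ ψ x) :
    gradient (fun y => φ y + ψ y) x = gradient φ x + gradient ψ x := by
  unfold gradient; rw [fderiv_fun_add h1 h2]; simp

theorem gradient_sub {N : ℕ} {φ ψ : Euc N → ℝ} {x : Euc N} (h1 : DifferentiableAt ℝ φ x)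
    (h2 : DifferentiableAt ℝ ψ x) :
    gradient (fun y => φ y - ψ y) x = gradient φ x - gradient ψ x := by
  unfold gradient; rw [fderiv_fun_sub h1 h2]; simp

theorem gradient_const_mul {N : ℕ} {φ : Euc N → ℝ} {x : Euc N} (c : ℝ)
    (h1 : DifferentiableAt ℝ φ x) :
    gradient (fun y => c * φ y) x = c • gradient φ x := by
  unfold gradient; rw [fderiv_const_mul h1]; simp

theorem gradient_const' {N : ℕ} (c : ℝ) (x : Euc N) : gradient (fun _ => c) x = 0 := by
  unfold gradient; simp

theorem fderiv_differentiableAt {N : ℕ} {φ : Euc N → ℝ} {x : Euc N} (h : ContDiffAt ℝ 2 φ x) :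
    DifferentiableAt ℝ (fderiv ℝ φ) x :=
  (h.fderiv_right (m := 1) (by norm_num)).differentiableAt (by norm_num)

/-- chain rule -/
theorem lapl_comp {N : ℕ} {r : Euc N → ℝ} {x : Euc N} {h h' : ℝ → ℝ} {h'' : ℝ}
    (hr : ContDiffAt ℝ 2 r x) (hh : ∀ᶠ t in 𝓝 (r x), HasDerivAt h (h' t) t)
    (hh' : HasDerivAt h' h'' (r x)) :
    lapl (fun y => h (r y)) x = h'' * ‖gradient r x‖ ^ 2 + h' (r x) * lapl r x := by
  have hd : ∀ᶠ y in 𝓝 x, DifferentiableAt ℝ r y := by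
    have := hr.eventually (by simp)
    filter_upwards [this] with y hy using hy.differentiableAt (by norm_num)
  have e1 : fderiv ℝ (fun y => h (r y)) =ᶠ[𝓝 x] fun y => h' (r y) • fderiv ℝ r y := by
    filter_upwards [hr.continuousAt.eventually hh, hd] with y h1 h2
    exact (h1.comp_hasFDerivAt y h2.hasFDerivAt).fderiv
  have d1 : HasFDerivAt (fun y => h' (r y)) (h'' • fderiv ℝ r x) x :=
    hh'.comp_hasFDerivAt x hd.self_of_nhds.hasFDerivAt
  have d2 := (fderiv_differentiableAt hr).hasFDerivAt
  have d3 := d1.smul d2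
  rw [lapl_eq_sum, lapl_eq_sum, norm_gradient_sq, Finset.mul_sum, Finset.mul_sum,
    ← Finset.sum_add_distrib]
  refine Finset.sum_congr rfl fun i _ => ?_
  rw [e1.fderiv_eq]
  erw [d3.fderiv]
  simp
  ring

theorem gradient_comp {N : ℕ} {r : Euc N → ℝ} {x : Euc N} {h : ℝ → ℝ} {h' : ℝ}
    (hr : DifferentiableAt ℝ r x) (hh : HasDerivAt h h' (r x)) :
    gradient (fun y => h (r y)) x = h' • gradient r x := by
  unfold gradient
  have := (hh.comp_hasFDerivAt x hr.hasFDerivAt).fderiv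
  rw [Function.comp_def] at this
  rw [this]; simp

/-- product rule -/
theorem lapl_mul {N : ℕ} {a b : Euc N → ℝ} {x : Euc N}
    (ha : ContDiffAt ℝ 2 a x) (hb : ContDiffAt ℝ 2 b x) :
    lapl (fun y => a y * b y) x =
      a x * lapl b x + 2 * inner ℝ (gradient a x) (gradient b x) + b x * lapl a x := by
  have key : ∀ c : Euc N → ℝ, ContDiffAt ℝ 2 c x →
      lapl (fun y => c y ^ 2) x = 2 * ‖gradient c x‖ ^ 2 + 2 * c x * lapl c x := by
    intro c hc
    have := lapl_comp (r := c) (x := x) (h := fun t => t ^ 2) (h' := fun t => 2 * t) (h'' := 2) hc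
      (Eventually.of_forall fun t => by simpa using hasDerivAt_pow 2 t)
      (by simpa using (hasDerivAt_id (c x)).const_mul (2 : ℝ))
    simpa using this
  have h1 := key (fun y => a y + b y) (ha.add hb)
  have h2 := key a ha
  have h3 := key b hb
  have e : (fun y => a y * b y) =
      fun y => (1 / 2 : ℝ) * (((a y + b y) ^ 2 - a y ^ 2) - b y ^ 2) := by
    funext y; ring
  have c1 : ContDiffAt ℝ 2 (fun y => (a y + b y) ^ 2) x := (ha.add hb).pow 2
  have c2 : ContDiffAt ℝ 2 (fun y => a y ^ 2) x := ha.pow 2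
  have c3 : ContDiffAt ℝ 2 (fun y => b y ^ 2) x := hb.pow 2
  rw [e, lapl_const_mul _ ((c1.sub c2).sub c3), lapl_sub (c1.sub c2) c3, lapl_sub c1 c2, h1, h2, h3,
    lapl_add ha hb, gradient_add (ha.differentiableAt (by norm_num))
      (hb.differentiableAt (by norm_num)), norm_add_sq_real]
  ring

theorem gradient_mul {N : ℕ} {a b : Euc N → ℝ} {x : Euc N}
    (ha : DifferentiableAt ℝ a x) (hb : DifferentiableAt ℝ b x) :
    gradient (fun y => a y * b y) x = a x • gradient b x + b x • gradient a x := by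
  unfold gradient; rw [fderiv_fun_mul ha hb]; simp

/-- squared distance -/
theorem gradient_sq {N : ℕ} (z x : Euc N) :
    gradient (fun y => ‖y - z‖ ^ 2) x = (2 : ℝ) • (x - z) := by
  apply ext_inner_right ℝ
  intro v
  rw [inner_gradient]
  have h : HasFDerivAt (fun y : Euc N => y - z) (ContinuousLinearMap.id ℝ (Euc N)) x :=
    (hasFDerivAt_id x).sub_const z
  have := h.norm_sq
  rw [this.fderiv]
  simp [inner_smul_left, inner_sub_left]

theorem contDiff_sq {N : ℕ} (z : Euc N) {n : WithTop ℕ∞} :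
    ContDiff ℝ n (fun y : Euc N => ‖y - z‖ ^ 2) :=
  (contDiff_id.sub contDiff_const).norm_sq ℝ

theorem lapl_sq {N : ℕ} (z x : Euc N) :
    lapl (fun y => ‖y - z‖ ^ 2) x = 2 * N := by
  rw [lapl_eq_sum]
  have : fderiv ℝ (fun y : Euc N => ‖y - z‖ ^ 2) = fun x => 2 • (innerSL ℝ (x - z)) := by
    funext x
    have h : HasFDerivAt (fun y : Euc N => y - z) (ContinuousLinearMap.id ℝ (Euc N)) x :=
      (hasFDerivAt_id x).sub_const z
    rw [h.norm_sq.fderiv]; rfl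
  rw [this]
  have h2 : HasFDerivAt (fun x : Euc N => 2 • (innerSL ℝ (x - z))) (2 • (innerSL ℝ : Euc N →L[ℝ] Euc N →L[ℝ] ℝ)) x := by
    have h : HasFDerivAt (fun y : Euc N => y - z) (ContinuousLinearMap.id ℝ (Euc N)) x :=
      (hasFDerivAt_id x).sub_const z
    have := ((innerSL ℝ : Euc N →L[ℝ] Euc N →L[ℝ] ℝ).hasFDerivAt.comp x h).const_smul (2 : ℕ)
    rw [ContinuousLinearMap.comp_id] at this
    exact this
  rw [h2.fderiv]
  refine (Finset.sum_congr rfl fun i _ => (?_ : _ = (2 : ℝ))).trans (by simp [mul_comm])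
  change 2 • inner ℝ (EuclideanSpace.single i (1 : ℝ)) (EuclideanSpace.single i (1 : ℝ)) = (2 : ℝ)
  rw [real_inner_self_eq_norm_sq]
  simp

theorem second_deriv_line {N : ℕ} {g : Euc N → ℝ} {x v : Euc N} (hg : ContDiffAt ℝ 2 g x) :
    (∀ᶠ t : ℝ in 𝓝 0, HasDerivAt (fun t : ℝ => g (x + t • v)) (fderiv ℝ g (x + t • v) v) t) ∧
    HasDerivAt (fun t : ℝ => fderiv ℝ g (x + t • v) v) (fderiv ℝ (fderiv ℝ g) x v v) 0 := by
  have hl : ∀ t : ℝ, HasDerivAt (fun t : ℝ => x + t • v) v t := fun t => by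
    simpa using ((hasDerivAt_id t).smul_const v).const_add x
  have hc : Tendsto (fun t : ℝ => x + t • v) (𝓝 0) (𝓝 x) := by
    have := (hl 0).continuousAt.tendsto
    simpa using this
  constructor
  · have := hg.eventually (by simp)
    filter_upwards [hc.eventually this] with t ht
    exact (ht.differentiableAt (by norm_num)).hasFDerivAt.comp_hasDerivAt t (hl t)
  · have h1 : HasFDerivAt (fderiv ℝ g) (fderiv ℝ (fderiv ℝ g) x) (x + (0 : ℝ) • v) := by
      simpa using (fderiv_differentiableAt hg).hasFDerivAt
    have h2 := h1.comp_hasDerivAt 0 (hl 0)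
    simpa using h2.clm_apply (hasDerivAt_const (0 : ℝ) v)

theorem second_deriv_nonpos {N : ℕ} {g : Euc N → ℝ} {x : Euc N} (hg : ContDiffAt ℝ 2 g x)
    (hm : IsLocalMax g x) (v : Euc N) : fderiv ℝ (fderiv ℝ g) x v v ≤ 0 := by
  by_contra! hpos
  obtain ⟨h1, h2⟩ := second_deriv_line (v := v) hg
  have hd : deriv (fun t : ℝ => g (x + t • v)) =ᶠ[𝓝 0] fun t => fderiv ℝ g (x + t • v) v := by
    filter_upwards [h1] with t ht using ht.deriv
  have hl : Continuous (fun t : ℝ => x + t • v) := by fun_prop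
  have hc : Tendsto (fun t : ℝ => x + t • v) (𝓝 0) (𝓝 x) := by
    have := hl.tendsto 0
    simpa using this
  have hz : fderiv ℝ g x = 0 := hm.fderiv_eq_zero
  have hmin : IsLocalMin (fun t : ℝ => g (x + t • v)) 0 := by
    apply isLocalMin_of_deriv_deriv_pos
    · rw [hd.deriv_eq, h2.deriv]; exact hpos
    · rw [hd.self_of_nhds]; simp [hz]
    · exact h1.self_of_nhds.continuousAt
  have hmax : ∀ᶠ t : ℝ in 𝓝 0, g (x + t • v) ≤ g x := hc.eventually hm
  have hconst : (fun t : ℝ => g (x + t • v)) =ᶠ[𝓝 0] fun _ => g x := by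
    filter_upwards [hmax, hmin] with t a b
    simp only [zero_smul, add_zero] at b
    exact le_antisymm a b
  have hd2 : deriv (fun t : ℝ => g (x + t • v)) =ᶠ[𝓝 0] fun _ => 0 := by
    have := hconst.deriv
    simpa using this
  have : deriv (deriv (fun t : ℝ => g (x + t • v))) 0 = 0 := by
    rw [hd2.deriv_eq]; simp
  rw [hd.deriv_eq, h2.deriv] at this
  linarith

theorem lapl_nonpos_of_max {N : ℕ} {g : Euc N → ℝ} {x : Euc N} (hg : ContDiffAt ℝ 2 g x)
    (hm : IsLocalMax g x) : lapl g x ≤ 0 := by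
  rw [lapl_eq_sum]
  exact Finset.sum_nonpos fun i _ => second_deriv_nonpos hg hm _

/-- comparison of derivatives at a touching point -/
theorem touch {N : ℕ} {a b : Euc N → ℝ} {x : Euc N} (ha : ContDiffAt ℝ 2 a x)
    (hb : ContDiffAt ℝ 2 b x) (hm : IsLocalMax (fun y => a y - b y) x) :
    gradient a x = gradient b x ∧ lapl a x ≤ lapl b x := by
  constructor
  · have h1 : gradient (fun y => a y - b y) x = 0 := by
      unfold gradient; rw [hm.fderiv_eq_zero]; simp
    rw [gradient_sub (ha.differentiableAt (by norm_num)) (hb.differentiableAt (by norm_num))] at h1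
    exact sub_eq_zero.mp h1
  · have := lapl_nonpos_of_max (ha.sub hb) hm
    rw [lapl_sub ha hb] at this
    linarith

/-- globalisation of local test functions -/
theorem globalize {N : ℕ} {φ : Euc N → ℝ} {x : Euc N} (h : ContDiffAt ℝ 2 φ x) :
    ∃ ψ : Euc N → ℝ, ContDiff ℝ 2 ψ ∧ ψ =ᶠ[𝓝 x] φ := by
  have h1 : ∀ᶠ y in 𝓝 x, ContDiffAt ℝ 2 φ y := h.eventually (by simp)
  obtain ⟨r, hr, hb⟩ := Metric.eventually_nhds_iff_ball.mp h1
  let χ : ContDiffBump x := ⟨r / 4, r / 2, by linarith, by linarith⟩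
  refine ⟨fun y => χ y * φ y, ?_, ?_⟩
  · rw [contDiff_iff_contDiffAt]
    intro y
    by_cases hy : y ∈ ball x r
    · exact χ.contDiffAt.mul (hb y hy)
    · have : (fun y => χ y * φ y) =ᶠ[𝓝 y] fun _ => 0 := by
        have hy' : y ∉ tsupport χ := by
          rw [χ.tsupport_eq]
          intro hc
          apply hy
          rw [mem_ball]
          rw [mem_closedBall] at hc
          have : χ.rOut = r / 2 := rfl
          linarith
        have := notMem_tsupport_iff_eventuallyEq.mp hy'
        filter_upwards [this] with z hz
        simp [hz]
      exact contDiffAt_const.congr_of_eventuallyEq this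
  · filter_upwards [χ.eventuallyEq_one] with y hy
    simp [hy]

end SC

namespace SC

open scoped SchwartzMap Laplacian ContDiff in
theorem resolvent {N : ℕ} {ε : ℝ} (hε : 0 < ε) (F : 𝓢(Euc N, ℝ)) :
    ∃ w : 𝓢(Euc N, ℝ), ∀ x, w x - ε * lapl w x = F x := by
  set c : ℝ := 2 * Real.pi * Real.sqrt ε with hc
  have hc2 : c ^ 2 = ε * (2 * Real.pi) ^ 2 := by
    rw [hc, mul_pow, Real.sq_sqrt hε.le]; ring
  let g : Euc N → ℝ := fun x => (1 + ‖c • x‖ ^ 2) ^ (-1 : ℝ)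
  have hg : g.HasTemperateGrowth := by
    have h1 := Function.hasTemperateGrowth_one_add_norm_sq_rpow (Euc N) (-1)
    have h2 : Function.HasTemperateGrowth (fun x : Euc N => c • x) :=
      (c • ContinuousLinearMap.id ℝ (Euc N)).hasTemperateGrowth
    exact h1.comp h2
  have hn : Function.HasTemperateGrowth (fun x : Euc N => ‖x‖ ^ 2) :=
    Function.hasTemperateGrowth_norm_sq (Euc N)
  let Fc : 𝓢(Euc N, ℂ) := F.postcompCLM Complex.ofRealCLM
  let wc : 𝓢(Euc N, ℂ) := SchwartzMap.fourierMultiplierCLM ℂ g Fc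
  have key : wc - ε • Δ wc = Fc := by
    rw [SchwartzMap.laplacian_eq_fourierMultiplierCLM]
    have e1 : wc - ε • (-(2 * Real.pi) ^ 2 • SchwartzMap.fourierMultiplierCLM ℂ (fun x : Euc N => ‖x‖ ^ 2) wc)
        = SchwartzMap.fourierMultiplierCLM ℂ g Fc + (c ^ 2) • SchwartzMap.fourierMultiplierCLM ℂ (fun x : Euc N => ‖x‖ ^ 2) (SchwartzMap.fourierMultiplierCLM ℂ g Fc) := by
      rw [hc2, smul_smul, mul_neg, neg_smul, sub_neg_eq_add]
    refine e1.trans ?_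
    rw [SchwartzMap.fourierMultiplierCLM_fourierMultiplierCLM_apply hn hg]
    have e2 : (SchwartzMap.fourierMultiplierCLM ℂ g Fc) + (c ^ 2) • SchwartzMap.fourierMultiplierCLM ℂ ((fun x : Euc N => ‖x‖ ^ 2) * g) Fc
        = SchwartzMap.fourierMultiplierCLM ℂ (g + (c ^ 2) • ((fun x : Euc N => ‖x‖ ^ 2) * g)) Fc := by
      have hng : Function.HasTemperateGrowth ((fun x : Euc N => ‖x‖ ^ 2) * g) := hn.mul hg
      have hng2 : Function.HasTemperateGrowth ((c ^ 2) • ((fun x : Euc N => ‖x‖ ^ 2) * g)) :=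
        (Function.HasTemperateGrowth.const (c ^ 2)).mul hng
      rw [SchwartzMap.fourierMultiplierCLM_apply, SchwartzMap.fourierMultiplierCLM_apply,
        SchwartzMap.fourierMultiplierCLM_apply, SchwartzMap.smulLeftCLM_add hg hng2,
        SchwartzMap.smulLeftCLM_smul hng]
      rw [_root_.add_apply, FourierTransform.fourierInv_add, _root_.smul_apply, FourierTransform.fourierInv_smul]
    rw [e2]
    have e3 : (g + (c ^ 2) • ((fun x : Euc N => ‖x‖ ^ 2) * g)) = fun _ => (1 : ℝ) := by
      funext x
      simp only [g, Pi.add_apply, Pi.smul_apply, Pi.mul_apply, smul_eq_mul, norm_smul, mul_pow,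
        Real.norm_eq_abs, sq_abs, Real.rpow_neg_one]
      have : (1 + c ^ 2 * ‖x‖ ^ 2) ≠ 0 := by positivity
      field_simp
    rw [e3, SchwartzMap.fourierMultiplierCLM_const]
    simp
  refine ⟨wc.postcompCLM Complex.reCLM, fun x => ?_⟩
  have k := congrArg (fun h : 𝓢(Euc N, ℂ) => (h x).re) key
  simp only [_root_.sub_apply, _root_.smul_apply, SchwartzMap.laplacian_apply,
    Complex.sub_re, Complex.smul_re, smul_eq_mul] at k
  have hs : ContDiffAt ℝ 2 (wc : Euc N → ℂ) x := (wc.smooth 2).contDiffAt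
  have hl := hs.laplacian_CLM_comp_left (l := Complex.reCLM)
  have e : ((wc.postcompCLM Complex.reCLM : 𝓢(Euc N, ℝ)) : Euc N → ℝ) = Complex.reCLM ∘ wc := rfl
  rw [lapl_eq_laplacian, e, hl]
  have hF : (Fc x).re = F x := Complex.ofReal_re _
  rw [hF] at k
  simpa using k

/-- viscosity inequality `-Δu ≤ g` on an open set -/
def LapSub {N : ℕ} (O : Set (Euc N)) (g u : Euc N → ℝ) : Prop :=
  ∀ φ : Euc N → ℝ, ContDiff ℝ 2 φ → ∀ x ∈ O, IsLocalMax (fun y => u y - φ y) x →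
    -lapl φ x ≤ g x

open scoped SchwartzMap Laplacian ContDiff in
theorem resolvent_cmp {N : ℕ} {u g : Euc N → ℝ} (hu : Continuous u)
    (hu0 : Tendsto u (cocompact (Euc N)) (𝓝 0)) (hs : LapSub univ g u)
    {ε η : ℝ} (hε : 0 < ε) (hη : 0 ≤ η) {F w : 𝓢(Euc N, ℝ)} (hw : ∀ x, w x - ε * lapl w x = F x)
    (hF : ∀ x, u x + ε * g x ≤ F x + η) (x : Euc N) : u x ≤ w x + η := by
  by_contra! hx
  have hd : Tendsto (fun y => u y - w y) (cocompact (Euc N)) (𝓝 0) := by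
    simpa using hu0.sub (zero_at_infty w)
  have hev : ∀ᶠ y in cocompact (Euc N), u y - w y ≤ u x - w x := by
    filter_upwards [hd.eventually (gt_mem_nhds (show (0 : ℝ) < u x - w x by linarith))] with y hy
      using le_of_lt hy
  have hcont : Continuous (fun y => u y - w y) := hu.sub w.continuous
  obtain ⟨z, hz⟩ := hcont.exists_forall_ge' x hev
  have h1 := hs w (w.smooth 2) z (mem_univ _) (Eventually.of_forall hz)
  have h2 := hw z
  have h3 := hF z
  have h4 := hz x
  nlinarith

open scoped SchwartzMap Laplacian ContDiff in
theorem resolvent_lower {N : ℕ} {ε η : ℝ} (hε : 0 < ε) (hη : 0 ≤ η) {F w : 𝓢(Euc N, ℝ)}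
    (hw : ∀ x, w x - ε * lapl w x = F x) (hF : ∀ x, -η ≤ F x) (x : Euc N) : -η ≤ w x := by
  have hs : LapSub (N := N) univ (fun _ => 0) (fun _ => 0) := by
    intro φ hφ y _ hm
    have := (touch (a := fun _ => (0 : ℝ)) contDiffAt_const hφ.contDiffAt hm).2
    rw [lapl_const] at this
    linarith
  have := resolvent_cmp (u := fun _ => (0 : ℝ)) (g := fun _ => 0) continuous_const
    tendsto_const_nhds hs hε hη hw (fun x => by have := hF x; linarith) x
  linarith

open scoped SchwartzMap Laplacian ContDiff in
theorem resolvent_upper {N : ℕ} {ε η : ℝ} (hε : 0 < ε) (hη : 0 ≤ η) {F w : 𝓢(Euc N, ℝ)}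
    (hw : ∀ x, w x - ε * lapl w x = F x) (hF : ∀ x, F x ≤ η) (x : Euc N) : w x ≤ η := by
  have := resolvent_lower (F := -F) (w := -w) hε hη (fun y => ?_) (fun y => ?_) x
  · simp at this; linarith
  · have e : ((-w : 𝓢(Euc N, ℝ)) : Euc N → ℝ) = fun y => (-1) * w y := by
      funext y; simp
    rw [e, lapl_const_mul _ (w.smooth 2).contDiffAt]
    have := hw y
    simp; linarith
  · have := hF y
    simp; linarith

open scoped SchwartzMap Laplacian ContDiff in
theorem schwartz_bdd {N : ℕ} (φ : 𝓢(Euc N, ℝ)) : ∃ M : ℝ, 0 ≤ M ∧ ∀ x, |φ x| ≤ M := by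
  refine ⟨‖φ.toBoundedContinuousFunction‖, norm_nonneg _, fun x => ?_⟩
  exact φ.toBoundedContinuousFunction.norm_coe_le_norm x

open scoped SchwartzMap Laplacian ContDiff in
theorem schwartz_int_mul {N : ℕ} (φ ψ : 𝓢(Euc N, ℝ)) : Integrable (fun x => φ x * ψ x) :=
  (SchwartzMap.pairing (ContinuousLinearMap.mul ℝ ℝ) φ ψ).integrable

theorem int_cs_mul {N : ℕ} {u v : Euc N → ℝ} (hu : Continuous u) (hc : HasCompactSupport u)
    (hv : Continuous v) : Integrable (fun x => u x * v x) :=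
  (hu.mul hv).integrable_of_hasCompactSupport hc.mul_right

open scoped SchwartzMap Laplacian ContDiff in
theorem smooth_approx {N : ℕ} {v χ : Euc N → ℝ} (hv : Continuous v) (hc : HasCompactSupport v)
    (hχ : ContDiff ℝ ∞ χ) (hχc : HasCompactSupport χ) (hχ0 : ∀ x, 0 ≤ χ x)
    (hχ1 : ∀ x, v x ≠ 0 → χ x = 1) {η : ℝ} (hη : 0 < η) :
    ∃ F : 𝓢(Euc N, ℝ), ∀ x, |F x - v x| ≤ η * χ x := by
  obtain ⟨G, hG, hGd⟩ := (hc.uniformContinuous_of_continuous hv).exists_contDiff_dist_le hη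
  have h1 : HasCompactSupport (fun x => χ x * G x) := hχc.mul_right
  refine ⟨h1.toSchwartzMap (hχ.mul hG), fun x => ?_⟩
  change |χ x * G x - v x| ≤ _
  have e : χ x * G x - v x = χ x * (G x - v x) := by
    by_cases h : v x = 0
    · simp [h]
    · simp [hχ1 x h]
  rw [e, abs_mul, abs_of_nonneg (hχ0 x), mul_comm]
  have := (hGd x).le
  rw [Real.dist_eq] at this
  exact mul_le_mul_of_nonneg_right this (hχ0 x)

open scoped SchwartzMap Laplacian ContDiff in
theorem global_dist {N : ℕ} {u g : Euc N → ℝ} (hu : Continuous u) (huc : HasCompactSupport u)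
    (hg : Continuous g) (hgc : HasCompactSupport g) (hs : LapSub univ g u)
    (φ : 𝓢(Euc N, ℝ)) (hφ : ∀ x, 0 ≤ φ x) :
    ∫ x, u x * (-lapl φ x) ≤ ∫ x, g x * φ x := by
  -- the cutoff
  obtain ⟨R, hR0, hR⟩ : ∃ R : ℝ, 0 < R ∧ ∀ x, (u x ≠ 0 ∨ g x ≠ 0) → x ∈ closedBall (0 : Euc N) R := by
    obtain ⟨R1, h1⟩ := huc.isCompact.isBounded.subset_closedBall 0
    obtain ⟨R2, h2⟩ := hgc.isCompact.isBounded.subset_closedBall 0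
    refine ⟨max 1 (max R1 R2), by positivity, fun x hx => ?_⟩
    rcases hx with hx | hx
    · exact closedBall_subset_closedBall (by simp) (h1 (subset_tsupport _ hx))
    · exact closedBall_subset_closedBall (by simp) (h2 (subset_tsupport _ hx))
  let χ : ContDiffBump (0 : Euc N) := ⟨R, R + 1, hR0, by linarith⟩
  have hχ1 : ∀ x, (u x ≠ 0 ∨ g x ≠ 0) → χ x = 1 := fun x hx => χ.one_of_mem_closedBall (hR x hx)
  obtain ⟨M, hM0, hM⟩ := schwartz_bdd φ
  obtain ⟨D1, hD10, hD1⟩ := schwartz_bdd (Δ φ)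
  obtain ⟨D2, hD20, hD2⟩ := schwartz_bdd (Δ (Δ φ))
  have lapS : ∀ ψ : 𝓢(Euc N, ℝ), ∀ x, (Δ ψ) x = lapl ψ x := fun ψ x => by
    rw [lapl_eq_laplacian, SchwartzMap.laplacian_apply]
  have iχ : Integrable (fun x => χ x) :=
    χ.continuous.integrable_of_hasCompactSupport χ.hasCompactSupport
  have iu : Integrable (fun x => |u x|) := (hu.integrable_of_hasCompactSupport huc).abs
  have ig : Integrable (fun x => |g x|) := (hg.integrable_of_hasCompactSupport hgc).abs
  set C : ℝ := (∫ x, |u x|) * D2 + (∫ x, |g x|) * D1 + (M * (∫ x, χ x) + ∫ x, φ x) with hC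
  suffices H : ∀ ε > 0, ∫ x, u x * (-lapl φ x) ≤ (∫ x, g x * φ x) + ε * C by
    have ht : Tendsto (fun ε : ℝ => (∫ x, g x * φ x) + ε * C) (𝓝[>] 0) (𝓝 ((∫ x, g x * φ x) + 0 * C)) := by
      apply Tendsto.mono_left _ nhdsWithin_le_nhds
      exact (Continuous.tendsto (by fun_prop) 0)
    rw [zero_mul, add_zero] at ht
    exact ge_of_tendsto ht (eventually_mem_nhdsWithin.mono fun ε hε => H ε hε)
  intro ε hε
  obtain ⟨s, hsol⟩ := resolvent hε (Δ (Δ φ))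
  obtain ⟨F, hF⟩ := smooth_approx (v := fun x => u x + ε * g x) (χ := χ)
    (hu.add (continuous_const.mul hg)) (huc.add hgc.mul_left) χ.contDiff χ.hasCompactSupport
    (fun x => χ.nonneg) (fun x hx => hχ1 x (by
      by_contra! h; apply hx; simp [h.1, h.2])) (η := ε ^ 2) (by positivity)
  obtain ⟨w, hw⟩ := resolvent hε F
  let q : 𝓢(Euc N, ℝ) := Δ φ + ε • s
  let p : 𝓢(Euc N, ℝ) := φ + ε • q
  have hqx : ∀ x, q x = lapl φ x + ε * s x := fun x => by
    rw [← lapS]; simp [q]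
  have hpx : ∀ x, p x = φ x + ε * q x := fun x => by simp [p]
  have hq : ∀ x, q x - ε * lapl q x = (Δ φ) x := fun x => by
    have e : (q : Euc N → ℝ) = fun y => (Δ φ) y + ε * s y := by
      funext y; simp [q]
    have h1 : lapl q x = lapl (⇑(Δ φ : 𝓢(Euc N, ℝ))) x + ε * lapl s x := by
      rw [e, lapl_add ((Δ φ).smooth 2).contDiffAt (contDiffAt_const.mul (s.smooth 2).contDiffAt),
        lapl_const_mul _ (s.smooth 2).contDiffAt]
    rw [h1, hqx, lapS]
    have := hsol x
    rw [lapS] at this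
    linear_combination ε * this
  have hp : ∀ x, p x - ε * lapl p x = φ x := fun x => by
    have e : (p : Euc N → ℝ) = fun y => φ y + ε * q y := by
      funext y; simp [p]
    have h1 : lapl p x = lapl φ x + ε * lapl q x := by
      rw [e, lapl_add (φ.smooth 2).contDiffAt (contDiffAt_const.mul (q.smooth 2).contDiffAt),
        lapl_const_mul _ (q.smooth 2).contDiffAt]
    rw [h1, hpx]
    have := hq x
    rw [lapS] at this
    linear_combination ε * this
  have hp0 : ∀ x, 0 ≤ p x := fun x => by
    have := resolvent_lower hε le_rfl hp (fun x => by simpa using hφ x) x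
    linarith
  have hpM : ∀ x, p x ≤ M := resolvent_upper hε hM0 hp (fun x => (abs_le.mp (hM x)).2)
  have hsb : ∀ x, |s x| ≤ D2 := fun x => abs_le.mpr
    ⟨resolvent_lower hε hD20 hsol (fun x => (abs_le.mp (hD2 x)).1) x,
      resolvent_upper hε hD20 hsol (fun x => (abs_le.mp (hD2 x)).2) x⟩
  have hqb : ∀ x, |q x| ≤ D1 := fun x => abs_le.mpr
    ⟨resolvent_lower hε hD10 hq (fun x => (abs_le.mp (hD1 x)).1) x,
      resolvent_upper hε hD10 hq (fun x => (abs_le.mp (hD1 x)).2) x⟩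
  have huw : ∀ x, u x ≤ w x + ε ^ 2 := by
    refine resolvent_cmp hu huc.is_zero_at_infty hs hε (by positivity) hw fun x => ?_
    have h1 := (abs_le.mp (hF x)).1
    have h2 : χ x ≤ 1 := χ.le_one
    nlinarith [sq_nonneg ε]
  -- integrate
  have I1 : ∫ x, u x * φ x ≤ ∫ x, (w x * φ x + ε ^ 2 * φ x) := by
    apply integral_mono (int_cs_mul hu huc φ.continuous)
      ((schwartz_int_mul w φ).add (φ.integrable.const_mul _))
    intro x
    have := mul_le_mul_of_nonneg_right (huw x) (hφ x)
    change u x * φ x ≤ w x * φ x + ε ^ 2 * φ x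
    linarith
  rw [integral_add (schwartz_int_mul w φ) (φ.integrable.const_mul _), integral_const_mul] at I1
  have I2 : ∫ x, w x * φ x = ∫ x, F x * p x := by
    have a1 : ∫ x, w x * φ x = (∫ x, w x * p x) - ε * ∫ x, w x * (Δ p) x := by
      rw [← integral_const_mul, ← integral_sub (schwartz_int_mul w p)
        ((schwartz_int_mul w (Δ p)).const_mul _)]
      congr 1; funext x
      rw [← hp x, lapS]; ring
    have a2 : ∫ x, F x * p x = (∫ x, w x * p x) - ε * ∫ x, (Δ w) x * p x := by
      rw [← integral_const_mul, ← integral_sub (schwartz_int_mul w p)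
        ((schwartz_int_mul (Δ w) p).const_mul _)]
      congr 1; funext x
      rw [← hw x, lapS]; ring
    rw [a1, a2, SchwartzMap.integral_mul_laplacian_right_eq_left]
  have iup : Integrable (fun x => u x * p x) := int_cs_mul hu huc p.continuous
  have igp : Integrable (fun x => g x * p x) := int_cs_mul hg hgc p.continuous
  have I3 : ∫ x, F x * p x ≤ ∫ x, ((u x * p x + ε * (g x * p x)) + ε ^ 2 * M * χ x) := by
    apply integral_mono (schwartz_int_mul F p) ((iup.add (igp.const_mul _)).add (iχ.const_mul _))
    intro x
    have h1 := (abs_le.mp (hF x)).2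
    have h2 := mul_le_mul_of_nonneg_right h1 (hp0 x)
    have h3 : ε ^ 2 * χ x * p x ≤ ε ^ 2 * χ x * M :=
      mul_le_mul_of_nonneg_left (hpM x) (mul_nonneg (by positivity) χ.nonneg)
    change F x * p x ≤ (u x * p x + ε * (g x * p x)) + ε ^ 2 * M * χ x
    linarith
  have iadd : Integrable (fun x => u x * p x + ε * (g x * p x)) := iup.add (igp.const_mul _)
  rw [integral_add iadd (iχ.const_mul _), integral_add iup (igp.const_mul _),
    integral_const_mul, integral_const_mul] at I3
  have iuq : Integrable (fun x => u x * q x) := int_cs_mul hu huc q.continuous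
  have ius : Integrable (fun x => u x * s x) := int_cs_mul hu huc s.continuous
  have iuφ : Integrable (fun x => u x * φ x) := int_cs_mul hu huc φ.continuous
  have igφ : Integrable (fun x => g x * φ x) := int_cs_mul hg hgc φ.continuous
  have igq : Integrable (fun x => g x * q x) := int_cs_mul hg hgc q.continuous
  have iul : Integrable (fun x => u x * (-lapl φ x)) := by
    have := int_cs_mul hu huc (Δ φ).continuous
    simp only [lapS] at this
    simpa using this.neg
  have J1 : ∫ x, u x * p x = (∫ x, u x * φ x) + ε * ∫ x, u x * q x := by
    rw [← integral_const_mul, ← integral_add iuφ (iuq.const_mul _)]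
    congr 1; funext x; rw [hpx]; ring
  have J2 : ∫ x, g x * p x = (∫ x, g x * φ x) + ε * ∫ x, g x * q x := by
    rw [← integral_const_mul, ← integral_add igφ (igq.const_mul _)]
    congr 1; funext x; rw [hpx]; ring
  have J3 : ∫ x, u x * q x = -(∫ x, u x * (-lapl φ x)) + ε * ∫ x, u x * s x := by
    have iuln : Integrable (fun x => -(u x * (-lapl φ x))) := iul.neg
    rw [← integral_const_mul, ← integral_neg, ← integral_add iuln (ius.const_mul _)]
    congr 1; funext x; rw [hqx]; ring
  have B : ∀ (v : Euc N → ℝ) (r : 𝓢(Euc N, ℝ)) (D : ℝ), Integrable (fun x => v x * r x) →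
      Integrable (fun x => |v x|) → (∀ x, |r x| ≤ D) → |∫ x, v x * r x| ≤ (∫ x, |v x|) * D := by
    intro v r D h1 h2 h3
    rw [← integral_mul_const]
    refine (abs_integral_le_integral_abs).trans (integral_mono h1.abs (h2.mul_const _) fun x => ?_)
    simp only [abs_mul]
    exact mul_le_mul_of_nonneg_left (h3 x) (abs_nonneg _)
  have B1 := (abs_le.mp (B u s D2 ius iu hsb)).2
  have B2 := (abs_le.mp (B g q D1 igq ig hqb)).2
  have fin : ε * (∫ x, u x * (-lapl φ x)) ≤ ε * ((∫ x, g x * φ x) + ε * C) := by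
    rw [I2] at I1
    rw [J1, J2, J3] at I3
    have e1 := mul_le_mul_of_nonneg_left B1 (sq_nonneg ε)
    have e2 := mul_le_mul_of_nonneg_left B2 (sq_nonneg ε)
    rw [hC]
    nlinarith
  exact le_of_mul_le_mul_left fin hε

end SC

namespace SC

theorem continuous_lapl {N : ℕ} {φ : Euc N → ℝ} (h : ContDiff ℝ 2 φ) : Continuous (lapl φ) := by
  unfold lapl
  refine continuous_finset_sum _ fun i _ => ?_
  have h1 : Continuous (fun x => iteratedFDeriv ℝ 2 φ x) :=
    h.continuous_iteratedFDeriv (by norm_num)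
  exact (continuous_eval_const _).comp h1

theorem continuous_gradient {N : ℕ} {φ : Euc N → ℝ} (h : ContDiff ℝ 2 φ) :
    Continuous (gradient φ) := by
  unfold gradient
  exact (LinearIsometryEquiv.continuous _).comp (h.continuous_fderiv (by norm_num))

theorem lapl_zero_of_support {N : ℕ} {φ : Euc N → ℝ} {x₀ : Euc N} {r : ℝ}
    (hφ : ∀ x, r < dist x x₀ → φ x = 0) {x : Euc N} (hx : r < dist x x₀) : lapl φ x = 0 := by
  have : φ =ᶠ[𝓝 x] fun _ => 0 := by
    have : ∀ᶠ y in 𝓝 x, r < dist y x₀ := 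
      (continuous_id.dist continuous_const).continuousAt.eventually (lt_mem_nhds hx)
    exact this.mono fun y hy => hφ y hy
  rw [lapl_congr this, lapl_const]

open scoped ContDiff in
theorem local_dist {N : ℕ} {O : Set (Euc N)} {u g : Euc N → ℝ} (hO : IsOpen O)
    (hu : ContinuousOn u O) (hg : ContinuousOn g O) (hs : LapSub O g u)
    {x₀ : Euc N} {r d : ℝ} (hr : 0 < r) (hd : 0 < d) (hb : closedBall x₀ (r + 4 * d) ⊆ O)
    {φ : Euc N → ℝ} (hφ : ContDiff ℝ ∞ φ) (hφ0 : ∀ x, 0 ≤ φ x)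
    (hφs : ∀ x, r < dist x x₀ → φ x = 0) :
    ∫ x, u x * (-lapl φ x) ≤ ∫ x, g x * φ x := by
  let χ0 : ContDiffBump x₀ := ⟨r, r + d, hr, by linarith⟩
  let χ1 : ContDiffBump x₀ := ⟨r + d, r + 2 * d, by linarith, by linarith⟩
  let χ2 : ContDiffBump x₀ := ⟨r + 3 * d, r + 4 * d, by linarith, by linarith⟩
  let χ3 : ContDiffBump x₀ := ⟨r + 4 * d, r + 4 * d + 1, by linarith, by linarith⟩
  have hK : IsCompact (closedBall x₀ (r + 4 * d)) := isCompact_closedBall _ _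
  obtain ⟨M0, hM0⟩ := hK.exists_bound_of_continuousOn (hu.mono hb)
  obtain ⟨G, hG⟩ := hK.exists_bound_of_continuousOn (hg.mono hb)
  simp only [Real.norm_eq_abs, mem_closedBall] at hM0 hG
  have hM00 : 0 ≤ M0 := (abs_nonneg _).trans (hM0 x₀ (by simp; positivity))
  have hG0 : 0 ≤ G := (abs_nonneg _).trans (hG x₀ (by simp; positivity))
  set M := M0 + 1 with hM
  let P : Euc N → ℝ := fun y => 2 * M * χ2 y - 4 * M * χ1 y
  have hP : ContDiff ℝ 2 P := (contDiff_const.mul χ2.contDiff).sub (contDiff_const.mul χ1.contDiff)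
  obtain ⟨Λ, hΛ⟩ := hK.exists_bound_of_continuousOn (continuous_lapl hP).continuousOn
  simp only [Real.norm_eq_abs, mem_closedBall] at hΛ
  have hΛ0 : 0 ≤ Λ := (abs_nonneg _).trans (hΛ x₀ (by simp; positivity))
  -- values of P
  have P1 : ∀ y, dist y x₀ ≤ r + d → P y = -2 * M := fun y hy => by
    have h1 : χ1 y = 1 := χ1.one_of_mem_closedBall hy
    have h2 : χ2 y = 1 := χ2.one_of_mem_closedBall (by
      rw [mem_closedBall]; change dist y x₀ ≤ r + 3 * d; linarith)
    simp only [P, h1, h2]; ring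
  have P2 : ∀ y, r + 2 * d ≤ dist y x₀ → dist y x₀ ≤ r + 3 * d → P y = 2 * M := fun y hy hy' => by
    have h1 : χ1 y = 0 := χ1.zero_of_le_dist hy
    have h2 : χ2 y = 1 := χ2.one_of_mem_closedBall hy'
    simp only [P, h1, h2]; ring
  have P3 : ∀ y, r + 4 * d ≤ dist y x₀ → P y = 0 := fun y hy => by
    have h1 : χ1 y = 0 := χ1.zero_of_le_dist (by change r + 2 * d ≤ _; linarith)
    have h2 : χ2 y = 0 := χ2.zero_of_le_dist hy
    simp only [P, h1, h2]; ring
  classical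
  let v : Euc N → ℝ := fun y => if dist y x₀ < r + 3 * d then max (u y) (P y) else P y
  let γ : Euc N → ℝ := fun y => χ2 y * g y + (Λ + G) * (χ3 y - χ0 y)
  have hdist : Continuous fun y => dist y x₀ := continuous_id.dist continuous_const
  have vin : ∀ y, dist y x₀ < r + 3 * d → v =ᶠ[𝓝 y] fun y => max (u y) (P y) := fun y hy => by
    have : ∀ᶠ z in 𝓝 y, dist z x₀ < r + 3 * d := hdist.continuousAt.eventually (gt_mem_nhds hy)
    exact this.mono fun z hz => if_pos hz
  have vout : ∀ y, r + 2 * d < dist y x₀ → v =ᶠ[𝓝 y] P := fun y hy => by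
    have : ∀ᶠ z in 𝓝 y, r + 2 * d < dist z x₀ := hdist.continuousAt.eventually (lt_mem_nhds hy)
    refine this.mono fun z hz => ?_
    by_cases h : dist z x₀ < r + 3 * d
    · have h1 : v z = max (u z) (P z) := if_pos h
      rw [h1, P2 z hz.le h.le, max_eq_right]
      have := (abs_le.mp (hM0 z (by linarith))).2
      linarith
    · exact if_neg h
  have huat : ∀ y, dist y x₀ ≤ r + 4 * d → ContinuousAt u y := fun y hy =>
    hu.continuousAt (hO.mem_nhds (hb hy))
  have hv : Continuous v := by
    rw [continuous_iff_continuousAt]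
    intro y
    rcases lt_or_ge (dist y x₀) (r + 3 * d) with h | h
    · have hc : ContinuousAt (fun y => max (u y) (P y)) y :=
        (huat y (by linarith)).max hP.continuous.continuousAt
      exact hc.congr (vin y h).symm
    · exact hP.continuous.continuousAt.congr (vout y (by linarith)).symm
  have hvc : HasCompactSupport v := by
    apply HasCompactSupport.of_support_subset_isCompact hK
    intro y hy
    by_contra hc
    simp only [mem_closedBall, not_le] at hc
    exact hy ((vout y (by linarith)).self_of_nhds.trans (P3 y hc.le))
  have hγ : Continuous γ := by
    refine Continuous.add ?_ (continuous_const.mul (χ3.continuous.sub χ0.continuous))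
    refine ContinuousOn.continuous_of_tsupport_subset (s := O) (χ2.continuous.continuousOn.mul hg) hO ?_
    refine (closure_mono (Function.support_mul_subset_left _ _)).trans ?_
    exact χ2.tsupport_eq.subset.trans hb
  have hγc : HasCompactSupport γ := by
    apply HasCompactSupport.of_support_subset_isCompact (isCompact_closedBall x₀ (r + 4 * d + 1))
    intro y hy
    by_contra hc
    simp only [mem_closedBall, not_le] at hc
    apply hy
    have h0 : χ0 y = 0 := χ0.zero_of_le_dist (by change r + d ≤ _; linarith)
    have h2 : χ2 y = 0 := χ2.zero_of_le_dist (by change r + 4 * d ≤ _; linarith)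
    have h3 : χ3 y = 0 := χ3.zero_of_le_dist hc.le
    simp only [γ, h0, h2, h3]; ring
  have hcmp : ∀ (ψ : Euc N → ℝ) (a : Euc N → ℝ) (x : Euc N), IsLocalMax (fun y => v y - ψ y) x →
      a x = v x → (∀ᶠ y in 𝓝 x, a y ≤ v y) → IsLocalMax (fun y => a y - ψ y) x := by
    intro ψ a x h1 h2 h3
    filter_upwards [h1, h3] with y hy hy'
    rw [h2]; linarith
  have caseP : ∀ ψ : Euc N → ℝ, ContDiff ℝ 2 ψ → ∀ x, IsLocalMax (fun y => v y - ψ y) x →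
      v x = P x → (∀ᶠ y in 𝓝 x, P y ≤ v y) → r + d < dist x x₀ → -lapl ψ x ≤ γ x := by
    intro ψ hψ x hm hx he hd'
    have ht := (touch hP.contDiffAt hψ.contDiffAt (hcmp ψ P x hm hx.symm he)).2
    have h0 : χ0 x = 0 := χ0.zero_of_le_dist hd'.le
    rcases le_or_gt (dist x x₀) (r + 4 * d) with h | h
    · have h3 : χ3 x = 1 := χ3.one_of_mem_closedBall h
      have h1 := (abs_le.mp (hΛ x h)).1
      have h2 := (abs_le.mp (hG x h)).1
      have h4 : -G ≤ χ2 x * g x := by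
        have a1 : 0 ≤ χ2 x := χ2.nonneg
        have a2 : χ2 x ≤ 1 := χ2.le_one
        nlinarith
      simp only [γ, h0, h3]; linarith
    · have h1 : lapl P x = 0 := lapl_zero_of_support (r := r + 4 * d) (fun y hy => P3 y hy.le) h
      have h2 : χ2 x = 0 := χ2.zero_of_le_dist h.le
      have h3 : 0 ≤ χ3 x := χ3.nonneg
      simp only [γ, h0, h2]
      nlinarith
  have key : LapSub univ γ v := by
    intro ψ hψ x _ hm
    rcases lt_or_ge (dist x x₀) (r + 3 * d) with h | h
    · have hvx : v x = max (u x) (P x) := if_pos h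
      rcases le_or_gt (P x) (u x) with hc | hc
      · have := hs ψ hψ x (hb (by rw [mem_closedBall]; linarith)) (hcmp ψ u x hm
          (by rw [hvx, max_eq_left hc]) ((vin x h).mono fun y hy => by rw [hy]; exact le_max_left _ _))
        have h2 : χ2 x = 1 := χ2.one_of_mem_closedBall h.le
        have h3 : χ3 x = 1 := χ3.one_of_mem_closedBall (by
          rw [mem_closedBall]; change dist x x₀ ≤ r + 4 * d; linarith)
        have h0 : χ0 x ≤ 1 := χ0.le_one
        simp only [γ, h2, h3]
        nlinarith
      · refine caseP ψ hψ x hm (by rw [hvx, max_eq_right hc.le])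
          ((vin x h).mono fun y hy => by rw [hy]; exact le_max_right _ _) ?_
        by_contra! hcc
        rw [P1 x hcc] at hc
        have := (abs_le.mp (hM0 x (by linarith))).1
        linarith
    · have hv' := vout x (by linarith)
      exact caseP ψ hψ x hm hv'.self_of_nhds (hv'.mono fun y hy => hy.ge) (by linarith)
  have hφc : HasCompactSupport φ := by
    apply HasCompactSupport.of_support_subset_isCompact (isCompact_closedBall x₀ r)
    intro y hy
    by_contra hc
    simp only [mem_closedBall, not_le] at hc
    exact hy (hφs y hc)
  have fin := global_dist hv hvc hγ hγc key (hφc.toSchwartzMap hφ) hφ0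
  have e1 : ∀ x, v x * (-lapl φ x) = u x * (-lapl φ x) := fun x => by
    rcases le_or_gt (dist x x₀) r with h | h
    · have h1 : v x = max (u x) (P x) := if_pos (by linarith)
      rw [h1, P1 x (by linarith), max_eq_left]
      have := (abs_le.mp (hM0 x (by linarith))).1
      linarith
    · rw [lapl_zero_of_support hφs h]; simp
  have e2 : ∀ x, γ x * φ x = g x * φ x := fun x => by
    rcases le_or_gt (dist x x₀) r with h | h
    · have h2 : χ2 x = 1 := χ2.one_of_mem_closedBall (by
          rw [mem_closedBall]; change dist x x₀ ≤ r + 3 * d; linarith)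
      have h3 : χ3 x = 1 := χ3.one_of_mem_closedBall (by
          rw [mem_closedBall]; change dist x x₀ ≤ r + 4 * d; linarith)
      have h0 : χ0 x = 1 := χ0.one_of_mem_closedBall h
      simp only [γ, h0, h2, h3]; ring
    · rw [hφs x h]; simp
  have c1 : (fun x => v x * (-lapl φ x)) = fun x => u x * (-lapl φ x) := funext e1
  have c2 : (fun x => γ x * φ x) = fun x => g x * φ x := funext e2
  rw [← c1, ← c2]
  exact fin

end SC

namespace SC

theorem gradient_inner {N : ℕ} (b x : Euc N) : gradient (fun y : Euc N => inner ℝ b y) x = b := by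
  apply ext_inner_right ℝ
  intro v
  rw [inner_gradient]
  have : (fun y : Euc N => inner ℝ b y) = innerSL ℝ b := rfl
  rw [this, ContinuousLinearMap.fderiv]; rfl

theorem contDiff_inner_left {N : ℕ} (b : Euc N) {n : WithTop ℕ∞} :
    ContDiff ℝ n (fun y : Euc N => inner ℝ b y) := (innerSL ℝ b).contDiff

theorem lapl_inner {N : ℕ} (b x : Euc N) : lapl (fun y : Euc N => inner ℝ b y) x = 0 := by
  rw [lapl_eq_sum]
  have : fderiv ℝ (fun y : Euc N => inner ℝ b y) = fun _ => innerSL ℝ b := by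
    funext z
    exact (innerSL ℝ b).fderiv
  rw [this]; simp

theorem contDiff_expb {N : ℕ} (b : Euc N) {n : WithTop ℕ∞} :
    ContDiff ℝ n (fun y : Euc N => Real.exp (inner ℝ b y)) :=
  Real.contDiff_exp.comp (contDiff_inner_left b)

theorem gradient_expb {N : ℕ} (b x : Euc N) :
    gradient (fun y : Euc N => Real.exp (inner ℝ b y)) x = Real.exp (inner ℝ b x) • b := by
  rw [gradient_comp (h := Real.exp) ((contDiff_inner_left b (n := 1)).differentiable (by simp) x)
    (Real.hasDerivAt_exp _), gradient_inner]

theorem lapl_expb {N : ℕ} (b x : Euc N) :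
    lapl (fun y : Euc N => Real.exp (inner ℝ b y)) x = Real.exp (inner ℝ b x) * ‖b‖ ^ 2 := by
  rw [lapl_comp (h := Real.exp) (h' := Real.exp) (contDiff_inner_left b).contDiffAt
    (Eventually.of_forall fun t => Real.hasDerivAt_exp t) (Real.hasDerivAt_exp _), gradient_inner,
    lapl_inner]
  ring

/-- viscosity inequality `-Δu + b·Du ≤ g` -/
def DriftSub {N : ℕ} (O : Set (Euc N)) (b : Euc N) (g u : Euc N → ℝ) : Prop :=
  ∀ φ : Euc N → ℝ, ContDiff ℝ 2 φ → ∀ x ∈ O, IsLocalMax (fun y => u y - φ y) x →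
    -lapl φ x + inner ℝ b (gradient φ x) ≤ g x

/-- writing the drift as `2 b`. -/
theorem drift_lapsub {N : ℕ} {O : Set (Euc N)} {b : Euc N} {g u : Euc N → ℝ}
    (h : DriftSub O ((2 : ℝ) • b) g u) :
    LapSub O (fun y => Real.exp (inner ℝ (-b) y) * (g y - ‖b‖ ^ 2 * u y))
      (fun y => Real.exp (inner ℝ (-b) y) * u y) := by
  intro φ hφ x hx hm
  set k := Real.exp (inner ℝ (-b) x) * u x - φ x with hk
  have hee : ∀ y : Euc N, Real.exp (inner ℝ b y) * Real.exp (inner ℝ (-b) y) = 1 := fun y => by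
    rw [← Real.exp_add]; simp
  have hm' : IsLocalMax (fun y => u y - Real.exp (inner ℝ b y) * (φ y + k)) x := by
    filter_upwards [hm] with y hy
    have e1 : φ x + k = Real.exp (inner ℝ (-b) x) * u x := by rw [hk]; ring
    rw [e1, ← mul_assoc, hee, one_mul, sub_self]
    have h1 : Real.exp (inner ℝ (-b) y) * u y ≤ φ y + k := by rw [hk]; linarith
    have h2 := mul_le_mul_of_nonneg_left h1 (Real.exp_pos (inner ℝ b y)).le
    rw [← mul_assoc, hee, one_mul] at h2
    linarith
  have hφk : ContDiff ℝ 2 (fun y => φ y + k) := hφ.add contDiff_const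
  have hφd : DifferentiableAt ℝ φ x := hφ.differentiable (by norm_num) x
  have key := h _ ((contDiff_expb b).mul hφk) x hx hm'
  have gk : gradient (fun y => φ y + k) x = gradient φ x := by
    rw [gradient_add hφd (by fun_prop), gradient_const', add_zero]
  have lk : lapl (fun y => φ y + k) x = lapl φ x := by
    rw [lapl_add hφ.contDiffAt contDiffAt_const, lapl_const, add_zero]
  rw [lapl_mul (contDiff_expb b).contDiffAt hφk.contDiffAt,
    gradient_mul ((contDiff_expb b (n := 1)).differentiable (by simp) x)
      (hφk.differentiable (by norm_num) x), gradient_expb, lapl_expb, gk, lk] at key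
  have e1 : φ x + k = Real.exp (inner ℝ (-b) x) * u x := by rw [hk]; ring
  have hbb : inner ℝ b b = ‖b‖ ^ 2 := real_inner_self_eq_norm_sq b
  simp only [inner_add_right, inner_smul_left, inner_smul_right, hbb, e1, map_ofNat,
    RCLike.conj_to_real] at key
  set E := Real.exp (inner ℝ b x)
  set e := Real.exp (inner ℝ (-b) x)
  have hEe : E * e = 1 := hee x
  have he : 0 < e := Real.exp_pos _
  have := mul_le_mul_of_nonneg_left key he.le
  have h3 : e * (g x - ‖b‖ ^ 2 * u x) = e * g x - e * u x * ‖b‖ ^ 2 := by ring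
  have h4 : e * (-(E * lapl φ x + 2 * (E * inner ℝ b (gradient φ x)) + e * u x * (E * ‖b‖ ^ 2)) +
    2 * (E * inner ℝ b (gradient φ x) + e * u x * (E * ‖b‖ ^ 2))) = (E * e) * (- lapl φ x) +
      (E * e) * e * u x * ‖b‖ ^ 2 := by ring
  rw [hEe] at h4
  linarith

theorem int_loc {N : ℕ} {O : Set (Euc N)} {u φ : Euc N → ℝ} (hO : IsOpen O)
    (hu : ContinuousOn u O) {x₀ : Euc N} {r : ℝ} (hb : closedBall x₀ r ⊆ O)
    (hφ : Continuous φ) (hφs : ∀ x, r < dist x x₀ → φ x = 0) : Integrable (fun x => u x * φ x) := by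
  have hss : Function.support (fun x => u x * φ x) ⊆ closedBall x₀ r := fun y hy => by
    by_contra hc
    simp only [mem_closedBall, not_le] at hc
    exact hy (by simp [hφs y hc])
  refine Continuous.integrable_of_hasCompactSupport ?_
    (HasCompactSupport.of_support_subset_isCompact (isCompact_closedBall x₀ r) hss)
  exact ContinuousOn.continuous_of_tsupport_subset (s := O) (hu.mul hφ.continuousOn) hO
    ((closure_minimal hss isClosed_closedBall).trans hb)

theorem grad_zero_of_support {N : ℕ} {φ : Euc N → ℝ} {x₀ : Euc N} {r : ℝ}
    (hφ : ∀ x, r < dist x x₀ → φ x = 0) {x : Euc N} (hx : r < dist x x₀) : gradient φ x = 0 := by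
  have : φ =ᶠ[𝓝 x] fun _ => 0 := by
    have : ∀ᶠ y in 𝓝 x, r < dist y x₀ :=
      (continuous_id.dist continuous_const).continuousAt.eventually (lt_mem_nhds hx)
    exact this.mono fun y hy => hφ y hy
  rw [gradient_congr this, gradient_const']

open scoped ContDiff in
theorem drift_dist {N : ℕ} {O : Set (Euc N)} {u g : Euc N → ℝ} {b : Euc N} (hO : IsOpen O)
    (hu : ContinuousOn u O) (hg : ContinuousOn g O) (hs : DriftSub O b g u)
    {x₀ : Euc N} {r d : ℝ} (hr : 0 < r) (hd : 0 < d) (hb : closedBall x₀ (r + 4 * d) ⊆ O)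
    {φ : Euc N → ℝ} (hφ : ContDiff ℝ ∞ φ) (hφ0 : ∀ x, 0 ≤ φ x)
    (hφs : ∀ x, r < dist x x₀ → φ x = 0) :
    ∫ x, u x * (-lapl φ x - inner ℝ b (gradient φ x)) ≤ ∫ x, g x * φ x := by
  obtain ⟨a, rfl⟩ : ∃ a : Euc N, b = (2 : ℝ) • a := ⟨(1 / 2 : ℝ) • b, by rw [smul_smul]; norm_num⟩
  have hec : Continuous (fun y : Euc N => Real.exp (inner ℝ (-a) y)) :=
    (contDiff_expb (-a) (n := 1)).continuous
  have hφ2 : ContDiff ℝ 2 φ := hφ.of_le (by norm_cast)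
  have key := local_dist (u := fun y => Real.exp (inner ℝ (-a) y) * u y)
    (g := fun y => Real.exp (inner ℝ (-a) y) * (g y - ‖a‖ ^ 2 * u y)) hO (hec.continuousOn.mul hu)
    (hec.continuousOn.mul (hg.sub (continuousOn_const.mul hu))) (drift_lapsub hs) hr hd hb
    (φ := fun y => Real.exp (inner ℝ a y) * φ y)
    ((contDiff_expb a).mul hφ) (fun x => mul_nonneg (Real.exp_pos _).le (hφ0 x))
    (fun x hx => by simp [hφs x hx])
  have hee : ∀ y : Euc N, Real.exp (inner ℝ (-a) y) * Real.exp (inner ℝ a y) = 1 := fun y => by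
    rw [← Real.exp_add]; simp
  have hb' : closedBall x₀ r ⊆ O := (closedBall_subset_closedBall (by linarith)).trans hb
  have i0 := (int_loc hO hu hb' hφ.continuous hφs)
  have i1 := (int_loc hO hg hb' hφ.continuous hφs)
  have i2 : Integrable (fun x => u x * (-lapl φ x - inner ℝ ((2 : ℝ) • a) (gradient φ x))) := by
    refine int_loc hO hu hb' ?_ fun x hx => ?_
    · exact (continuous_lapl hφ2).neg.sub (continuous_const.inner (continuous_gradient hφ2))
    · rw [lapl_zero_of_support hφs hx, grad_zero_of_support hφs hx]; simp
  have e1 : (fun x => Real.exp (inner ℝ (-a) x) * u x * (-lapl (fun y => Real.exp (inner ℝ a y) * φ y) x))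
      = fun x => u x * (-lapl φ x - inner ℝ ((2 : ℝ) • a) (gradient φ x)) - ‖a‖ ^ 2 * (u x * φ x) := by
    funext x
    rw [lapl_mul (contDiff_expb a).contDiffAt hφ2.contDiffAt, gradient_expb, lapl_expb]
    simp only [inner_smul_left, map_ofNat, RCLike.conj_to_real]
    linear_combination (u x * (-lapl φ x - 2 * inner ℝ a (gradient φ x)) - ‖a‖ ^ 2 * (u x * φ x)) * hee x
  have e2 : (fun x => Real.exp (inner ℝ (-a) x) * (g x - ‖a‖ ^ 2 * u x) * (Real.exp (inner ℝ a x) * φ x))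
      = fun x => g x * φ x - ‖a‖ ^ 2 * (u x * φ x) := by
    funext x
    linear_combination ((g x - ‖a‖ ^ 2 * u x) * φ x) * hee x
  rw [e1, e2, integral_sub i2 (i0.const_mul _), integral_sub i1 (i0.const_mul _)] at key
  linarith

end SC

namespace SC

theorem lapl_eq_iter {N : ℕ} {φ : Euc N → ℝ} (h : ContDiff ℝ 2 φ) (x : Euc N) :
    lapl φ x = ∑ i : Fin N, fderiv ℝ (fun y => fderiv ℝ φ y (EuclideanSpace.single i 1)) x
      (EuclideanSpace.single i 1) := by
  rw [lapl_eq_sum]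
  refine Finset.sum_congr rfl fun i _ => ?_
  have := fderiv_differentiableAt (h.contDiffAt (x := x))
  rw [fderiv_clm_apply this (by fun_prop)]
  simp

open scoped ContDiff Convolution

/-- convolution -/
noncomputable def conv {N : ℕ} (w η : Euc N → ℝ) : Euc N → ℝ :=
  w ⋆[ContinuousLinearMap.mul ℝ ℝ, volume] η

theorem conv_apply {N : ℕ} (w η : Euc N → ℝ) (x : Euc N) :
    conv w η x = ∫ t, w t * η (x - t) := rfl

theorem conv_int {N : ℕ} {w η : Euc N → ℝ} (hw : LocallyIntegrable w)
    (hc : HasCompactSupport η) (hη : Continuous η) (x : Euc N) :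
    Integrable (fun t => w t * η (x - t)) :=
  (hc.convolutionExists_right (ContinuousLinearMap.mul ℝ ℝ) hw hη x :)

theorem conv_contDiff {N : ℕ} {w η : Euc N → ℝ} (hw : LocallyIntegrable w)
    (hc : HasCompactSupport η) (hη : ContDiff ℝ ∞ η) : ContDiff ℝ ∞ (conv w η) :=
  hc.contDiff_convolution_right (n := ⊤) (ContinuousLinearMap.mul ℝ ℝ) hw hη

theorem conv_fderiv {N : ℕ} {w η : Euc N → ℝ} (hw : LocallyIntegrable w)
    (hc : HasCompactSupport η) (hη : ContDiff ℝ ∞ η) (x v : Euc N) :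
    fderiv ℝ (conv w η) x v = conv w (fun a => fderiv ℝ η a v) x := by
  have h1 : ContDiff ℝ 1 η := hη.of_le (by norm_cast)
  have := (hc.hasFDerivAt_convolution_right (ContinuousLinearMap.mul ℝ ℝ) hw h1 x).fderiv
  unfold conv
  rw [this]
  exact convolution_precompR_apply _ hw (hc.fderiv ℝ) (h1.continuous_fderiv (by norm_num)) x v

theorem conv_lapl {N : ℕ} {w η : Euc N → ℝ} (hw : LocallyIntegrable w)
    (hc : HasCompactSupport η) (hη : ContDiff ℝ ∞ η) (x : Euc N) :
    lapl (conv w η) x = conv w (lapl η) x := by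
  have h2 : ContDiff ℝ 2 (conv w η) := (conv_contDiff hw hc hη).of_le (by norm_cast)
  have h2' : ContDiff ℝ 2 η := hη.of_le (by norm_cast)
  have hD : ∀ v : Euc N, ContDiff ℝ ∞ (fun a => fderiv ℝ η a v) := fun v =>
    (hη.fderiv_right (m := ∞) (by norm_cast)).clm_apply contDiff_const
  have hDc : ∀ v : Euc N, HasCompactSupport (fun a => fderiv ℝ η a v) := fun v =>
    hc.fderiv_apply ℝ v
  rw [lapl_eq_iter h2, conv_apply]
  have e : ∀ t, w t * lapl η (x - t) = ∑ i : Fin N, w t * fderiv ℝ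
      (fun y => fderiv ℝ η y (EuclideanSpace.single i 1)) (x - t) (EuclideanSpace.single i 1) := by
    intro t; rw [lapl_eq_iter h2', Finset.mul_sum]
  simp_rw [e]
  rw [integral_finset_sum _ fun i _ => ?_]
  · refine Finset.sum_congr rfl fun i _ => ?_
    have : (fun y => fderiv ℝ (conv w η) y (EuclideanSpace.single i 1)) =
      conv w (fun a => fderiv ℝ η a (EuclideanSpace.single i 1)) := by
      funext y; exact conv_fderiv hw hc hη y _
    rw [this, conv_fderiv hw (hDc _) (hD _), conv_apply]
  · exact conv_int hw ((hDc _).fderiv_apply ℝ _)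
      ((((hD _).fderiv_right (m := ∞) (by norm_cast)).clm_apply contDiff_const).continuous) x

theorem fderiv_refl {N : ℕ} {η : Euc N → ℝ} (h : Differentiable ℝ η) (x t v : Euc N) :
    fderiv ℝ (fun s => η (x - s)) t v = - fderiv ℝ η (x - t) v := by
  have h1 : HasFDerivAt (fun s : Euc N => x - s) (-ContinuousLinearMap.id ℝ (Euc N)) t :=
    (hasFDerivAt_id t).const_sub x
  have := ((h (x - t)).hasFDerivAt.comp t h1).fderiv
  change fderiv ℝ (η ∘ fun s => x - s) t v = _
  rw [this]; simp

theorem lapl_refl {N : ℕ} {η : Euc N → ℝ} (h : ContDiff ℝ 2 η) (x t : Euc N) :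
    lapl (fun s => η (x - s)) t = lapl η (x - t) := by
  have hc : ContDiff ℝ 2 (fun s => η (x - s)) := h.comp (contDiff_const.sub contDiff_id)
  rw [lapl_eq_iter h, lapl_eq_iter hc]
  refine Finset.sum_congr rfl fun i _ => ?_
  have hd : Differentiable ℝ η := h.differentiable (by norm_num)
  have : (fun y => fderiv ℝ (η ∘ fun s => x - s) y (EuclideanSpace.single i 1)) =
      fun y => - fderiv ℝ η (x - y) (EuclideanSpace.single i 1) := by
    funext y; exact fderiv_refl hd x y _
  change fderiv ℝ (fun y => fderiv ℝ (η ∘ fun s => x - s) y (EuclideanSpace.single i 1)) t _ = _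
  rw [this]
  have hd2 : Differentiable ℝ (fun y => fderiv ℝ η y (EuclideanSpace.single i (1:ℝ))) :=
    ((h.fderiv_right (m := 1) (by norm_num)).clm_apply contDiff_const).differentiable (by norm_num)
  rw [fderiv_fun_neg]
  have := fderiv_refl hd2 x t (EuclideanSpace.single i 1)
  simp [this]

theorem gradient_refl {N : ℕ} {η : Euc N → ℝ} (h : Differentiable ℝ η) (x t : Euc N) :
    gradient (fun s => η (x - s)) t = - gradient η (x - t) := by
  apply ext_inner_right ℝ
  intro v
  rw [inner_gradient, fderiv_refl h, inner_neg_left, inner_gradient]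

/-- viscosity inequality `-Δu + |Du|^m ≤ F` -/
def HJSub {N : ℕ} (O : Set (Euc N)) (m : ℝ) (F u : Euc N → ℝ) : Prop :=
  ∀ φ : Euc N → ℝ, ContDiff ℝ 2 φ → ∀ x ∈ O, IsLocalMax (fun y => u y - φ y) x →
    -lapl φ x + ‖gradient φ x‖ ^ m ≤ F x

theorem young_vec {N : ℕ} {m : ℝ} (hm : 2 < m) (p q : Euc N) :
    inner ℝ ((m * ‖q‖ ^ (m - 2)) • q) p - (m - 1) * ‖q‖ ^ m ≤ ‖p‖ ^ m := by
  have hc : Real.HolderConjugate m (Real.conjExponent m) := Real.HolderConjugate.conjExponent (by linarith)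
  have hy := Real.young_inequality_of_nonneg (norm_nonneg p)
    (Real.rpow_nonneg (norm_nonneg q) (m - 1)) hc
  have e1 : (‖q‖ ^ (m - 1)) ^ (Real.conjExponent m) = ‖q‖ ^ m := by
    rw [← Real.rpow_mul (norm_nonneg q)]
    congr 1
    unfold Real.conjExponent; field_simp
    have : m - 1 ≠ 0 := by linarith
    field_simp
  have e2 : ‖q‖ ^ m / Real.conjExponent m = ‖q‖ ^ m * (m - 1) / m := by
    unfold Real.conjExponent
    rw [div_div_eq_mul_div]
  have e3 : ‖q‖ ^ (m - 2) * ‖q‖ = ‖q‖ ^ (m - 1) := by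
    rcases eq_or_lt_of_le (norm_nonneg q) with h | h
    · rw [← h, mul_zero, Real.zero_rpow (by linarith)]
    · nth_rewrite 2 [← Real.rpow_one ‖q‖]
      rw [← Real.rpow_add h]; congr 1; ring
  rw [e1, e2] at hy
  rw [inner_smul_left]
  simp only [RCLike.conj_to_real]
  have h1 : inner ℝ q p ≤ ‖q‖ * ‖p‖ := real_inner_le_norm q p
  have hm0 : 0 < m := by linarith
  have h2 : 0 ≤ m * ‖q‖ ^ (m - 2) := by positivity
  have h3 := mul_le_mul_of_nonneg_left h1 h2
  have h4 : m * ‖q‖ ^ (m - 2) * (‖q‖ * ‖p‖) = m * (‖p‖ * ‖q‖ ^ (m - 1)) := by rw [← e3]; ring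
  have h5 := mul_le_mul_of_nonneg_left hy hm0.le
  have h6 : m * (‖p‖ ^ m / m + ‖q‖ ^ m * (m - 1) / m) = ‖p‖ ^ m + ‖q‖ ^ m * (m - 1) := by field_simp
  linarith

theorem hj_drift {N : ℕ} {O : Set (Euc N)} {m : ℝ} (hm : 2 < m) {F u : Euc N → ℝ}
    (h : HJSub O m F u) (q : Euc N) :
    DriftSub O ((m * ‖q‖ ^ (m - 2)) • q) (fun y => F y + (m - 1) * ‖q‖ ^ m) u := by
  intro φ hφ x hx hmx
  have h1 := h φ hφ x hx hmx
  have h2 := young_vec hm (gradient φ x) q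
  linarith

/-- Mollification of a viscosity subsolution. -/
theorem mollify {N : ℕ} {O S : Set (Euc N)} (hO : IsOpen O) (hS : IsCompact S) (hOS : O ⊆ S)
    {m : ℝ} (hm : 2 < m) {F u : Euc N → ℝ} (hu : ContinuousOn u S) (hF : ContinuousOn F O)
    (h : HJSub O m F u) {ε : ℝ} (hε : 0 < ε) :
    ∃ U : Euc N → ℝ, ContDiff ℝ 2 U ∧ ∀ x, closedBall x ε ⊆ O →
      (∀ c, (∀ y ∈ closedBall x ε, F y ≤ c) → -lapl U x + ‖gradient U x‖ ^ m ≤ c) ∧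
      (∀ c, (∀ y ∈ closedBall x ε, u y ≤ c) → U x ≤ c) ∧
      (∀ c, (∀ y ∈ closedBall x ε, c ≤ u y) → c ≤ U x) := by
  let χ : ContDiffBump (0 : Euc N) := ⟨ε / 2, ε, by linarith, by linarith⟩
  let η : Euc N → ℝ := χ.normed volume
  have hη : ContDiff ℝ ∞ η := χ.contDiff_normed
  have hη2 : ContDiff ℝ 2 η := hη.of_le (by norm_cast)
  have hηd : Differentiable ℝ η := hη2.differentiable (by norm_num)
  have hηc : HasCompactSupport η := χ.hasCompactSupport_normed
  have hη0 : ∀ x, 0 ≤ η x := χ.nonneg_normed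
  have hη1 : ∀ x, ∫ t, η (x - t) = 1 := fun x => by
    rw [integral_sub_left_eq_self]; exact χ.integral_normed
  have hηs : ∀ x t, ε < dist t x → η (x - t) = 0 := fun x t ht => by
    have : x - t ∉ Function.support η := by
      rw [χ.support_normed_eq]
      simp only [mem_ball_zero_iff, not_lt]
      rw [← dist_eq_norm, dist_comm]; exact ht.le
    simpa using this
  let w : Euc N → ℝ := S.indicator u
  have hw : LocallyIntegrable w :=
    ((hu.integrableOn_compact hS).integrable_indicator hS.measurableSet).locallyIntegrable
  refine ⟨conv w η, (conv_contDiff hw hηc hη).of_le (by norm_cast), fun x hx => ?_⟩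
  have mean : ∀ v : Euc N → ℝ, ContinuousOn v O → ∀ c, (∀ y ∈ closedBall x ε, v y ≤ c) →
      ∫ t, v t * η (x - t) ≤ c := by
    intro v hv c hc
    have i1 := int_loc hO hv hx (φ := fun t => η (x - t))
      (hη.continuous.comp (continuous_const.sub continuous_id)) (hηs x)
    have i2 : Integrable (fun t => η (x - t)) :=
      (χ.integrable_normed (μ := volume)).comp_sub_left x
    calc ∫ t, v t * η (x - t) ≤ ∫ t, c * η (x - t) := by
          refine integral_mono i1 (i2.const_mul _) fun t => ?_
          rcases le_or_gt (dist t x) ε with ht | ht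
          · exact mul_le_mul_of_nonneg_right (hc t ht) (hη0 _)
          · simp [hηs x t ht]
      _ = c := by rw [integral_const_mul, hη1, mul_one]
  have wu : ∀ g : Euc N → ℝ, (∀ t, ε < dist t x → g t = 0) →
      ∫ t, w t * g t = ∫ t, u t * g t := by
    intro g hg
    congr 1; funext t
    rcases le_or_gt (dist t x) ε with ht | ht
    · have : t ∈ S := hOS (hx ht)
      simp [w, this]
    · simp [hg t ht]
  have huO := hu.mono hOS
  refine ⟨fun c hc => ?_, fun c hc => ?_, fun c hc => ?_⟩
  · -- main inequality
    set q := gradient (conv w η) x with hq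
    set b := (m * ‖q‖ ^ (m - 2)) • q with hb
    obtain ⟨d, hd, hbd⟩ : ∃ d > 0, closedBall x (ε + 4 * d) ⊆ O := by
      obtain ⟨δ, hδ, hsub⟩ := (isCompact_closedBall x ε).exists_cthickening_subset_open hO hx
      refine ⟨δ / 4, by positivity, ?_⟩
      rw [cthickening_closedBall hδ.le hε.le] at hsub
      refine (closedBall_subset_closedBall (le_of_eq ?_)).trans hsub
      ring
    have hψ : ContDiff ℝ ∞ (fun t => η (x - t)) := hη.comp (contDiff_const.sub contDiff_id)
    have key := drift_dist hO huO (hF.add continuousOn_const) (hj_drift hm h q) hε hd hbd hψ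
      (fun t => hη0 _) (hηs x)
    have hgq : ∫ t, (F t + (m - 1) * ‖q‖ ^ m) * η (x - t) ≤ c + (m - 1) * ‖q‖ ^ m :=
      mean _ (hF.add continuousOn_const) _ fun y hy => by simpa using hc y hy
    have e : ∫ t, u t * (-lapl (fun t => η (x - t)) t - inner ℝ b (gradient (fun t => η (x - t)) t))
        = - lapl (conv w η) x + inner ℝ b q := by
      rw [← wu _ (fun t ht => by
        rw [lapl_zero_of_support (hηs x) ht, grad_zero_of_support (hηs x) ht]; simp)]
      have hb1 : inner ℝ b q = conv w (fun a => inner ℝ b (gradient η a)) x := by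
        rw [hq, real_inner_comm, inner_gradient, conv_fderiv hw hηc hη]
        congr 1; funext a; rw [real_inner_comm, inner_gradient]
      have cg : HasCompactSupport (fun a => inner ℝ b (gradient η a)) := by
        have : (fun a => inner ℝ b (gradient η a)) = fun a => fderiv ℝ η a b := by
          funext a; rw [real_inner_comm, inner_gradient]
        rw [this]; exact hηc.fderiv_apply ℝ b
      have cl : HasCompactSupport (lapl η) := by
        refine HasCompactSupport.of_support_subset_isCompact (isCompact_closedBall (0 : Euc N) ε) fun y hy => ?_
        by_contra hcc
        simp only [mem_closedBall, not_le] at hcc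
        refine hy (lapl_zero_of_support (x₀ := 0) (r := ε) (fun z hz => ?_) hcc)
        have := hηs 0 (-z) (by simpa using hz)
        simpa using this
      have i1 := conv_int hw cl (continuous_lapl hη2) x
      have i1n : Integrable (fun t => -(w t * lapl η (x - t))) := i1.neg
      have i2 := conv_int hw cg (continuous_const.inner (continuous_gradient hη2)) x
      rw [hb1, conv_lapl hw hηc hη, conv_apply, conv_apply, ← integral_neg, ← integral_add i1n i2]
      congr 1; funext t
      rw [lapl_refl hη2, gradient_refl hηd, inner_neg_right]
      ring
    have hbq : inner ℝ b q = m * ‖q‖ ^ m := by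
      rw [hb, inner_smul_left, real_inner_self_eq_norm_sq]
      simp only [RCLike.conj_to_real]
      rcases eq_or_lt_of_le (norm_nonneg q) with h0 | h0
      · rw [← h0, Real.zero_rpow (by linarith : m ≠ 0)]; simp
      · rw [mul_assoc, ← Real.rpow_natCast ‖q‖ 2, ← Real.rpow_add h0]
        congr 2; push_cast; ring
    have key2 := key.trans hgq
    rw [e, hbq] at key2
    linarith
  · rw [conv_apply, wu _ (hηs x)]
    exact mean u huO c hc
  · rw [conv_apply, wu _ (hηs x)]
    have := mean (fun y => - u y) huO.neg (-c) fun y hy => by simpa using hc y hy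
    simp only [neg_mul, integral_neg] at this
    linarith

end SC

namespace SC

theorem geom {N : ℕ} {Ω : Set (Euc N)} (hO : IsOpen Ω) (h2 : HasC2Boundary Ω) {z : Euc N}
    (hz : z ∈ closure Ω) :
    ∃ (n : Euc N) (c t₀ r₀ : ℝ), 0 < c ∧ 0 < t₀ ∧ 0 < r₀ ∧
      ∀ x ∈ closure Ω, dist x z ≤ r₀ → ∀ t, 0 < t → t ≤ t₀ → closedBall (x + t • n) (c * t) ⊆ Ω := by
  by_cases hzΩ : z ∈ Ω
  · obtain ⟨R, hR, hb⟩ := Metric.isOpen_iff.mp hO z hzΩ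
    refine ⟨0, R / 4, 1, R / 4, by positivity, one_pos, by positivity, fun x _ hx t ht ht1 y hy => ?_⟩
    apply hb
    simp only [smul_zero, add_zero, mem_closedBall, mem_ball] at hy ⊢
    have := dist_triangle y x z
    nlinarith
  · obtain ⟨ρ, hρ, hΩ, hfr, hg⟩ := h2
    have hzf : z ∈ frontier Ω := by
      rw [frontier, hO.interior_eq]; exact ⟨hz, hzΩ⟩
    set g := gradient ρ z with hgdef
    have hg0 : 0 < ‖g‖ := norm_pos_iff.mpr (hg z hzf)
    have hcl : ∀ x ∈ closure Ω, ρ x ≤ 0 := by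
      have : closure Ω ⊆ {x | ρ x ≤ 0} := by
        apply closure_minimal _ (isClosed_le hρ.continuous continuous_const)
        rw [hΩ]; intro x hx; exact le_of_lt (show ρ x < 0 from hx)
      exact this
    have hs := (hρ.contDiffAt (x := z)).hasStrictFDerivAt (by norm_num)
    have hs' := hs.isLittleO.def (c := ‖g‖ / 4) (by positivity)
    rw [nhds_prod_eq] at hs'
    obtain ⟨δ, hδ, hb⟩ : ∃ δ > 0, ∀ y w, dist y z < δ → dist w z < δ →
        ‖ρ y - ρ w - fderiv ℝ ρ z (y - w)‖ ≤ ‖g‖ / 4 * ‖y - w‖ := by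
      obtain ⟨pa, ha, pb, hb, hab⟩ := eventually_prod_iff.mp hs'
      obtain ⟨δ1, h1, hb1⟩ := Metric.eventually_nhds_iff.mp ha
      obtain ⟨δ2, h2, hb2⟩ := Metric.eventually_nhds_iff.mp hb
      exact ⟨min δ1 δ2, lt_min h1 h2, fun y w hy hw => hab (hb1 (lt_of_lt_of_le hy (min_le_left _ _)))
        (hb2 (lt_of_lt_of_le hw (min_le_right _ _)))⟩
    refine ⟨-g, ‖g‖ / 4, δ / (4 * ‖g‖), δ / 2, by positivity, by positivity, by positivity,
      fun x hx hxz t ht ht1 y hy => ?_⟩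
    rw [mem_closedBall, dist_eq_norm] at hy
    set w := y - (x + t • -g) with hw
    have hyx : y - x = w - t • g := by rw [hw]; simp; abel
    have htg : t * ‖g‖ ≤ δ / 4 := by
      rw [le_div_iff₀ (by positivity)] at ht1; linarith
    have hn : ‖y - x‖ ≤ 5 / 4 * (t * ‖g‖) := by
      rw [hyx]
      refine (norm_sub_le _ _).trans ?_
      rw [norm_smul, Real.norm_eq_abs, abs_of_pos ht]; linarith
    have hyz : dist y z < δ := by
      have := dist_triangle y x z
      rw [dist_eq_norm y x] at this
      linarith
    have h := (abs_le.mp (hb y x hyz (by linarith))).2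
    rw [← inner_gradient, ← hgdef, hyx, inner_sub_right, inner_smul_right,
      real_inner_self_eq_norm_sq] at h
    rw [← hyx] at h
    have hgw : inner ℝ g w ≤ ‖g‖ * ‖w‖ := real_inner_le_norm g w
    have hρx := hcl x hx
    rw [hΩ]; change ρ y < 0
    have h5 : ‖g‖ * ‖w‖ ≤ ‖g‖ * (‖g‖ / 4 * t) := mul_le_mul_of_nonneg_left hy hg0.le
    have h6 : ‖g‖ / 4 * ‖y - x‖ ≤ ‖g‖ / 4 * (5 / 4 * (t * ‖g‖)) :=
      mul_le_mul_of_nonneg_left hn (by positivity)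
    have h7 : 0 < t * ‖g‖ ^ 2 := by positivity
    nlinarith

theorem lapl_translate {N : ℕ} (φ : Euc N → ℝ) (a x : Euc N) :
    lapl (fun y => φ (y + a)) x = lapl φ (x + a) := by
  rw [lapl_eq_sum, lapl_eq_sum]
  have : fderiv ℝ (fun y => φ (y + a)) = fun y => fderiv ℝ φ (y + a) := by
    funext y; exact fderiv_comp_add_right a
  rw [this, fderiv_comp_add_right]

theorem gradient_translate {N : ℕ} (φ : Euc N → ℝ) (a x : Euc N) :
    gradient (fun y => φ (y + a)) x = gradient φ (x + a) := by
  unfold gradient; rw [fderiv_comp_add_right]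

theorem smooth_sub {N : ℕ} {Ω : Set (Euc N)} (hO : IsOpen Ω) (hb : Bornology.IsBounded Ω)
    {m : ℝ} (hm : 2 < m) {F u : Euc N → ℝ} (hu : ContinuousOn u (closure Ω))
    (hF : ContinuousOn F (closure Ω)) (h : HJSub Ω m F u)
    {z n : Euc N} {c t₀ r₀ : ℝ} (hc : 0 < c) (ht₀ : 0 < t₀)
    (hg : ∀ x ∈ closure Ω, dist x z ≤ r₀ → ∀ t, 0 < t → t ≤ t₀ → closedBall (x + t • n) (c * t) ⊆ Ω)
    {e : ℝ} (he : 0 < e) :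
    ∃ U : Euc N → ℝ, ContDiff ℝ 2 U ∧ ∀ x ∈ closure Ω, dist x z ≤ r₀ →
      |U x - u x| ≤ e ∧ -lapl U x + ‖gradient U x‖ ^ m ≤ F x + e := by
  have hK : IsCompact (closure Ω) := hb.isCompact_closure
  obtain ⟨δ1, h1, hu1⟩ := Metric.uniformContinuousOn_iff.mp
    (hK.uniformContinuousOn_of_continuous hu) e he
  obtain ⟨δ2, h2, hF2⟩ := Metric.uniformContinuousOn_iff.mp
    (hK.uniformContinuousOn_of_continuous hF) e he
  set t := min t₀ (min δ1 δ2 / (2 * (‖n‖ + c))) with ht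
  have ht0 : 0 < t := by positivity
  have htt : t ≤ t₀ := min_le_left _ _
  have htd : t * (‖n‖ + c) < min δ1 δ2 := by
    have : t ≤ min δ1 δ2 / (2 * (‖n‖ + c)) := min_le_right _ _
    rw [le_div_iff₀ (by positivity)] at this
    have : 0 < min δ1 δ2 := lt_min h1 h2
    linarith
  obtain ⟨V, hV, hVp⟩ := mollify hO hK subset_closure hm hu (hF.mono subset_closure) h
    (ε := c * t) (by positivity)
  refine ⟨fun y => V (y + t • n), hV.comp (contDiff_id.add contDiff_const), fun x hx hxz => ?_⟩
  have hball := hg x hx hxz t ht0 htt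
  obtain ⟨a1, a2, a3⟩ := hVp (x + t • n) hball
  have hd : ∀ y ∈ closedBall (x + t • n) (c * t), dist y x < min δ1 δ2 := fun y hy => by
    refine lt_of_le_of_lt ((dist_triangle y (x + t • n) x).trans ?_) htd
    have : dist (x + t • n) x = t * ‖n‖ := by
      rw [dist_eq_norm, add_sub_cancel_left, norm_smul, Real.norm_eq_abs, abs_of_pos ht0]
    rw [this]; rw [mem_closedBall] at hy; linarith
  have hyc : ∀ y ∈ closedBall (x + t • n) (c * t), y ∈ closure Ω := fun y hy => subset_closure (hball hy)
  have hu' : ∀ y ∈ closedBall (x + t • n) (c * t), |u y - u x| < e := fun y hy =>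
    hu1 y (hyc y hy) x hx ((hd y hy).trans_le (min_le_left _ _))
  have hF' : ∀ y ∈ closedBall (x + t • n) (c * t), |F y - F x| < e := fun y hy =>
    hF2 y (hyc y hy) x hx ((hd y hy).trans_le (min_le_right _ _))
  constructor
  · have b2 := a2 (u x + e) fun y hy => by linarith [(abs_lt.mp (hu' y hy)).2]
    have b3 := a3 (u x - e) fun y hy => by linarith [(abs_lt.mp (hu' y hy)).1]
    rw [abs_le]; constructor <;> linarith
  · rw [lapl_translate, gradient_translate]
    exact a1 _ fun y hy => by linarith [(abs_lt.mp (hF' y hy)).2]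

/-- supersolution up to the boundary -/
def SCSuper {N : ℕ} (Ω : Set (Euc N)) (m lam : ℝ) (f v : Euc N → ℝ) : Prop :=
  ∀ φ : Euc N → ℝ, ContDiff ℝ 2 φ → ∀ x ∈ closure Ω,
    IsLocalMinOn (fun y => v y - φ y) (closure Ω) x →
    f x - lam * v x ≤ -lapl φ x + ‖gradient φ x‖ ^ m

theorem norm_rpow_convex {N : ℕ} {m : ℝ} (hm : 2 < m) (p q : Euc N) {a b : ℝ} (ha : 0 ≤ a)
    (hb : 0 ≤ b) (hab : a + b = 1) : ‖a • p + b • q‖ ^ m ≤ a * ‖p‖ ^ m + b * ‖q‖ ^ m := by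
  have h1 : ‖a • p + b • q‖ ≤ a * ‖p‖ + b * ‖q‖ := by
    refine (norm_add_le _ _).trans ?_
    rw [norm_smul, norm_smul, Real.norm_eq_abs, Real.norm_eq_abs, abs_of_nonneg ha, abs_of_nonneg hb]
  refine (Real.rpow_le_rpow (norm_nonneg _) h1 (by linarith)).trans ?_
  exact (convexOn_rpow (by linarith : 1 ≤ m)).2 (norm_nonneg p) (norm_nonneg q) ha hb hab

set_option maxHeartbeats 800000 in
theorem comparison {N : ℕ} {Ω : Set (Euc N)} (hO : IsOpen Ω) (hb : Bornology.IsBounded Ω)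
    (h2 : HasC2Boundary Ω) {m lam : ℝ} (hm : 2 < m) (hlam : 0 < lam) {f u v : Euc N → ℝ}
    (hf : ContinuousOn f (closure Ω))
    (hu : ContinuousOn u (closure Ω)) (hv : ContinuousOn v (closure Ω))
    (hsub : HJSub Ω m (fun y => f y - lam * u y) u) (hsup : SCSuper Ω m lam f v) :
    ∀ x ∈ closure Ω, u x ≤ v x := by
  by_contra! hcon
  obtain ⟨x₁, hx₁, hx₁'⟩ := hcon
  have hK : IsCompact (closure Ω) := hb.isCompact_closure
  obtain ⟨z, hz, hzmax⟩ := hK.exists_isMaxOn ⟨x₁, hx₁⟩ (hu.sub hv)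
  set M := u z - v z with hM
  have hmax : ∀ x ∈ closure Ω, u x - v x ≤ M := fun x hx => hzmax hx
  have hM0 : 0 < M := by linarith [hmax x₁ hx₁]
  obtain ⟨n, c, t₀, r₀, hc, ht₀, hr₀, hg⟩ := geom hO h2 hz
  obtain ⟨B, hB⟩ := hK.exists_bound_of_continuousOn hu
  obtain ⟨A, hA⟩ := hK.exists_bound_of_continuousOn hf
  simp only [Real.norm_eq_abs] at hB hA
  have hB0 : 0 ≤ B := (abs_nonneg _).trans (hB z hz)
  have hA0 : 0 ≤ A := (abs_nonneg _).trans (hA z hz)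
  set k := (2 * B + 1) / r₀ ^ 2 with hk
  have hk0 : 0 < k := by positivity
  have hkr : k * r₀ ^ 2 = 2 * B + 1 := by rw [hk]; field_simp
  set T := 2 * k * N + (2 * k * r₀) ^ m with hT
  have hT0 : 0 ≤ T := by positivity
  set D := lam * (B + 1 / 2) + 1 / 4 + T + A with hD
  have hD0 : 0 < D := by positivity
  set s := min (1 / 2) (lam * M / (2 * D)) with hs
  have hs0 : 0 < s := by positivity
  have hs1 : s ≤ 1 / 2 := min_le_left _ _
  have hsD : s * D < lam * M := by
    have : s ≤ lam * M / (2 * D) := min_le_right _ _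
    rw [le_div_iff₀ (by positivity)] at this
    have : 0 < lam * M := by positivity
    linarith
  have hF : ContinuousOn (fun y => f y - lam * u y) (closure Ω) := hf.sub (continuousOn_const.mul hu)
  obtain ⟨U, hU, hUp⟩ := smooth_sub hO hb hm hu hF hsub hc ht₀ hg (e := s / 4) (by positivity)
  let ψ : Euc N → ℝ := fun y => -k * ‖y - z‖ ^ 2
  have hψ : ContDiff ℝ 2 ψ := contDiff_const.mul (contDiff_sq z)
  let φ : Euc N → ℝ := fun y => (1 - s) * U y + s * ψ y
  have hφ : ContDiff ℝ 2 φ := (contDiff_const.mul hU).add (contDiff_const.mul hψ)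
  have hK2 : IsCompact (closure Ω ∩ closedBall z r₀) := hK.inter_right isClosed_closedBall
  have hzin : z ∈ closure Ω ∩ closedBall z r₀ := ⟨hz, by simp [hr₀.le]⟩
  obtain ⟨x, ⟨hx, hxr⟩, hxmin⟩ := hK2.exists_isMinOn ⟨z, hzin⟩
    (f := fun y => v y - φ y) ((hv.sub hφ.continuous.continuousOn).mono inter_subset_left)
  rw [mem_closedBall] at hxr
  have hmin : ∀ y ∈ closure Ω, dist y z ≤ r₀ → v x - φ x ≤ v y - φ y := fun y h1 h2 => hxmin ⟨h1, h2⟩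
  obtain ⟨q1, q2⟩ := hUp x hx hxr
  obtain ⟨q3, -⟩ := hUp z hz (by simp [hr₀.le])
  have hxz := hmin z hz (by simp [hr₀.le])
  have hφz : φ z = (1 - s) * U z := by simp [φ, ψ]
  have hψx : ψ x ≤ 0 := by
    have := mul_nonneg hk0.le (sq_nonneg ‖x - z‖)
    simp only [ψ]; linarith
  rw [hφz] at hxz
  have q1' := (abs_le.mp q1).2
  have q3' := (abs_le.mp q3).1
  have hBx := abs_le.mp (hB x hx)
  have hBz := abs_le.mp (hB z hz)
  have hφx : φ x = (1 - s) * U x + s * ψ x := rfl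
  have low : M - s * B - s / 4 ≤ φ x - v x := by
    have : (1 - s) * (u z - s / 4) ≤ (1 - s) * U z := mul_le_mul_of_nonneg_left (by linarith) (by linarith)
    have a1 := mul_le_mul_of_nonneg_left hBz.2 hs0.le
    have a2 := mul_self_nonneg s
    linarith
  have hUx : (1 - s) * U x ≤ (1 - s) * u x + s / 4 := by
    have : (1 - s) * U x ≤ (1 - s) * (u x + s / 4) := mul_le_mul_of_nonneg_left (by linarith) (by linarith)
    have a2 := mul_self_nonneg s
    linarith
  have hintr : dist x z < r₀ := by
    by_contra! hcc
    have hd : dist x z = r₀ := le_antisymm hxr hcc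
    have : ψ x = -(2 * B + 1) := by
      simp only [ψ]; rw [← dist_eq_norm, hd, ← hkr]; ring
    have := hmax x hx
    have a1 := mul_le_mul_of_nonneg_left hBx.1 hs0.le
    have a3 : s * ψ x = -(s * (2 * B + 1)) := by rw [‹ψ x = _›]; ring
    linarith
  have hloc : IsLocalMinOn (fun y => v y - φ y) (closure Ω) x := by
    have : ∀ᶠ y in 𝓝[closure Ω] x, dist y z < r₀ := by
      apply mem_nhdsWithin_of_mem_nhds
      exact (continuous_id.dist continuous_const).continuousAt.eventually (gt_mem_nhds hintr)
    filter_upwards [this, self_mem_nhdsWithin] with y hy hy'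
    exact hmin y hy' hy.le
  have key := hsup φ hφ x hx hloc
  have hUd : DifferentiableAt ℝ U x := hU.differentiable (by norm_num) x
  have hψd : DifferentiableAt ℝ ψ x := hψ.differentiable (by norm_num) x
  have lφ : lapl φ x = (1 - s) * lapl U x + s * lapl ψ x := by
    rw [lapl_add (contDiffAt_const.mul hU.contDiffAt) (contDiffAt_const.mul hψ.contDiffAt),
      lapl_const_mul _ hU.contDiffAt, lapl_const_mul _ hψ.contDiffAt]
  have gφ : gradient φ x = (1 - s) • gradient U x + s • gradient ψ x := by
    rw [gradient_add (hUd.const_mul _) (hψd.const_mul _), gradient_const_mul _ hUd,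
      gradient_const_mul _ hψd]
  have lψ : lapl ψ x = -(2 * k * N) := by
    rw [lapl_const_mul _ (contDiff_sq z).contDiffAt, lapl_sq]; ring
  have gψ : ‖gradient ψ x‖ ^ m ≤ (2 * k * r₀) ^ m := by
    rw [gradient_const_mul _ ((contDiff_sq z (n := 1)).differentiable (by simp) x), gradient_sq]
    refine Real.rpow_le_rpow (norm_nonneg _) ?_ (by linarith)
    rw [norm_smul, norm_smul, ← dist_eq_norm, Real.norm_eq_abs, Real.norm_eq_abs, abs_neg,
      abs_of_pos hk0]
    norm_num
    have := mul_le_mul_of_nonneg_left hxr hk0.le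
    linarith
  have conv := norm_rpow_convex hm (gradient U x) (gradient ψ x) (a := 1 - s) (b := s)
    (by linarith) hs0.le (by ring)
  rw [← gφ] at conv
  rw [lφ, lψ] at key
  have q2' := mul_le_mul_of_nonneg_left q2 (by linarith : (0:ℝ) ≤ 1 - s)
  have gψ' := mul_le_mul_of_nonneg_left gψ hs0.le
  have hAx := abs_le.mp (hA x hx)
  -- lam * ((1-s) u - v) ≤ s/4 + s (T + A)
  have main : lam * ((1 - s) * u x - v x) ≤ s / 4 + s * (T + A) := by
    rw [hT]
    have : s * f x ≥ s * (-A) := mul_le_mul_of_nonneg_left hAx.1 hs0.le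
    have a2 := mul_self_nonneg s
    linarith
  have low2 : M - s * B - s / 2 ≤ (1 - s) * u x - v x := by
    have : s * ψ x ≤ 0 := mul_nonpos_of_nonneg_of_nonpos hs0.le hψx
    linarith
  have := mul_le_mul_of_nonneg_left low2 hlam.le
  rw [hD] at hsD
  linarith

end SC

namespace SC

theorem slope_contra {N : ℕ} {φ : Euc N → ℝ} {x n : Euc N} (hφ : DifferentiableAt ℝ φ x) {k α : ℝ}
    (hk : 0 < k) (hα1 : α < 1)
    (h : ∀ᶠ t : ℝ in 𝓝[>] 0, φ (x + t • n) ≤ φ x - k * t ^ α) : False := by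
  have hl : HasDerivAt (fun t : ℝ => x + t • n) n 0 := by
    simpa using ((hasDerivAt_id (0 : ℝ)).smul_const n).const_add x
  have hd : HasDerivAt (fun t : ℝ => φ (x + t • n)) (fderiv ℝ φ x n) 0 := by
    have h1 : HasFDerivAt φ (fderiv ℝ φ x) (x + (0 : ℝ) • n) := by simpa using hφ.hasFDerivAt
    exact h1.comp_hasDerivAt 0 hl
  have ho := hd.isLittleO.def (c := 1) one_pos
  set L := |fderiv ℝ φ x n| + 1 with hL
  have hL0 : 0 < L := by positivity
  have ho' : ∀ᶠ t : ℝ in 𝓝[>] 0, φ x - L * t ≤ φ (x + t • n) := by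
    have := ho.filter_mono (nhdsWithin_le_nhds (s := Ioi (0 : ℝ)))
    filter_upwards [this, self_mem_nhdsWithin] with t ht ht0
    simp only [zero_smul, add_zero, sub_zero, smul_eq_mul, Real.norm_eq_abs, one_mul] at ht
    have ht0' : (0 : ℝ) < t := ht0
    rw [abs_of_pos ht0'] at ht
    have h1 := (abs_le.mp ht).1
    have h2 : t * (-|fderiv ℝ φ x n|) ≤ t * fderiv ℝ φ x n :=
      mul_le_mul_of_nonneg_left (neg_abs_le _) ht0'.le
    rw [hL]; linarith
  have hpow : Tendsto (fun t : ℝ => t ^ (1 - α)) (𝓝[>] 0) (𝓝 0) := by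
    have := (Real.continuousAt_rpow_const 0 (1 - α) (Or.inr (by linarith))).tendsto
    rw [Real.zero_rpow (by linarith)] at this
    exact this.mono_left nhdsWithin_le_nhds
  have hsm : ∀ᶠ t : ℝ in 𝓝[>] 0, t ^ (1 - α) < k / L := hpow.eventually (gt_mem_nhds (by positivity))
  have hall := (h.and (ho'.and (hsm.and self_mem_nhdsWithin))).exists
  obtain ⟨t, h1, h2, h3, h4⟩ := hall
  have ht0 : (0 : ℝ) < t := h4
  have e : t = t ^ (1 - α) * t ^ α := by
    rw [← Real.rpow_add ht0]; simp
  have hta : 0 < t ^ α := Real.rpow_pos_of_pos ht0 α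
  rw [lt_div_iff₀ hL0] at h3
  have h5 : k * t ^ α ≤ L * t := by linarith
  have h6 : L * t = (t ^ (1 - α) * L) * t ^ α := by
    calc L * t = L * (t ^ (1 - α) * t ^ α) := by rw [← e]
      _ = _ := by ring
  rw [h6] at h5
  have := mul_lt_mul_of_pos_right h3 hta
  linarith

/-- the exponent -/
theorem alpha_facts {m : ℝ} (hm : 2 < m) : 0 < (m - 2) / (m - 1) ∧ (m - 2) / (m - 1) < 1 ∧
    ((m - 2) / (m - 1) - 1) * m = (m - 2) / (m - 1) - 2 ∧
    ((m - 2) / (m - 1) - 1) * (m - 1) = -1 := by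
  have h1 : 0 < m - 1 := by linarith
  refine ⟨div_pos (by linarith) h1, (div_lt_one h1).mpr (by linarith), ?_, ?_⟩ <;>
  · field_simp; ring

theorem barrier_derivs {K α s : ℝ} (hs : s < 0) :
    HasDerivAt (fun t : ℝ => -K * (-t) ^ α) (K * α * (-s) ^ (α - 1)) s ∧
    HasDerivAt (fun t : ℝ => K * α * (-t) ^ (α - 1)) (K * α * (1 - α) * (-s) ^ (α - 2)) s := by
  have hn : HasDerivAt (fun t : ℝ => -t) (-1) s := hasDerivAt_neg s
  constructor
  · have := (hn.rpow_const (p := α) (Or.inl (by linarith))).const_mul (-K)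
    have e : K * α * (-s) ^ (α - 1) = -K * (-1 * α * (-s) ^ (α - 1)) := by ring
    rw [e]; exact this
  · have := (hn.rpow_const (p := α - 1) (Or.inl (by linarith))).const_mul (K * α)
    have e : K * α * (1 - α) * (-s) ^ (α - 2) = K * α * (-1 * (α - 1) * (-s) ^ (α - 1 - 1)) := by
      rw [show α - 1 - 1 = α - 2 by ring]; ring
    rw [e]; exact this

theorem upper_bound {N : ℕ} {Ω : Set (Euc N)} (hO : IsOpen Ω) (hb : Bornology.IsBounded Ω)
    (hne : Ω.Nonempty) (h2 : HasC2Boundary Ω) {m : ℝ} (hm : 2 < m) {f : Euc N → ℝ}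
    (hf : ContinuousOn f (closure Ω)) :
    ∃ A : ℝ, ∀ lam, 0 < lam → lam < 1 → ∀ u : Euc N → ℝ, ContinuousOn u (closure Ω) →
      HJSub Ω m (fun y => f y - lam * u y) u → ∀ x ∈ closure Ω, lam * u x ≤ A := by
  have h2' := h2
  obtain ⟨ρ, hρ, hΩ, hfr, hg⟩ := h2
  obtain ⟨x₁, hx₁⟩ := hne
  have hx₁c := subset_closure hx₁
  have hK : IsCompact (closure Ω) := hb.isCompact_closure
  have hcl : ∀ x ∈ closure Ω, ρ x ≤ 0 := by
    have : closure Ω ⊆ {x | ρ x ≤ 0} := by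
      apply closure_minimal _ (isClosed_le hρ.continuous continuous_const)
      rw [hΩ]; intro x hx; exact le_of_lt (show ρ x < 0 from hx)
    exact this
  have hin : ∀ x, x ∈ Ω ↔ ρ x < 0 := fun x => by rw [hΩ]; rfl
  have hgc : Continuous (gradient ρ) := continuous_gradient hρ
  -- lower bound for the gradient on the frontier
  obtain ⟨c₀, hc₀, hgr⟩ : ∃ c₀ : ℝ, 0 < c₀ ∧ ∀ x ∈ frontier Ω, c₀ < ‖gradient ρ x‖ := by
    have hfc : IsCompact (frontier Ω) := hK.of_isClosed_subset isClosed_frontier frontier_subset_closure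
    rcases (frontier Ω).eq_empty_or_nonempty with he | hne'
    · exact ⟨1, one_pos, fun x hx => by rw [he] at hx; exact hx.elim⟩
    · obtain ⟨y, hy, hmin⟩ := hfc.exists_isMinOn hne' hgc.norm.continuousOn
      have hy0 : 0 < ‖gradient ρ y‖ := norm_pos_iff.mpr (hg y hy)
      refine ⟨‖gradient ρ y‖ / 2, by positivity, fun x hx => ?_⟩
      have : ‖gradient ρ y‖ ≤ ‖gradient ρ x‖ := hmin hx
      linarith
  obtain ⟨s₀, hs₀, hdic⟩ : ∃ s₀ : ℝ, 0 < s₀ ∧ ∀ x ∈ closure Ω, ‖gradient ρ x‖ ≤ c₀ → s₀ ≤ -ρ x := by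
    have hE : IsCompact (closure Ω ∩ {x | ‖gradient ρ x‖ ≤ c₀}) :=
      hK.inter_right (isClosed_le hgc.norm continuous_const)
    rcases (closure Ω ∩ {x | ‖gradient ρ x‖ ≤ c₀}).eq_empty_or_nonempty with he | hne'
    · exact ⟨1, one_pos, fun x hx hx' => by
        have : x ∈ closure Ω ∩ {x | ‖gradient ρ x‖ ≤ c₀} := ⟨hx, hx'⟩
        rw [he] at this; exact this.elim⟩
    · obtain ⟨y, hy, hmin⟩ := hE.exists_isMinOn hne' hρ.continuous.neg.continuousOn
      refine ⟨-ρ y, ?_, fun x hx hx' => hmin ⟨hx, hx'⟩⟩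
      have h1 := hcl y hy.1
      rcases h1.lt_or_eq with h | h
      · linarith
      · have : y ∈ frontier Ω := by rw [hfr]; exact h
        exact absurd hy.2 (not_le.mpr (hgr y this))
  obtain ⟨S, hS⟩ := hK.exists_bound_of_continuousOn hρ.continuous.continuousOn
  obtain ⟨D, hD⟩ := hK.exists_bound_of_continuousOn (continuous_lapl hρ).continuousOn
  obtain ⟨A₁, hA₁⟩ := hK.exists_bound_of_continuousOn hf
  simp only [Real.norm_eq_abs] at hS hD hA₁
  have hS0 : 0 ≤ S := (abs_nonneg _).trans (hS x₁ hx₁c)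
  have hD0 : 0 ≤ D := (abs_nonneg _).trans (hD x₁ hx₁c)
  have hA₁0 : 0 ≤ A₁ := (abs_nonneg _).trans (hA₁ x₁ hx₁c)
  obtain ⟨hα0, hα1, hαm, -⟩ := alpha_facts hm
  set α := (m - 2) / (m - 1) with hα
  -- choice of K
  set Q := 1 + S * D / c₀ ^ 2 with hQ
  have hQ0 : 0 < Q := by positivity
  set κ := max 1 (Q / c₀ ^ (m - 2)) with hκ
  have hκ1 : 1 ≤ κ := le_max_left _ _
  have hκ0 : 0 < κ := by linarith
  have hκQ : Q ≤ κ * c₀ ^ (m - 2) := by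
    have : Q / c₀ ^ (m - 2) ≤ κ := le_max_right _ _
    rwa [div_le_iff₀ (by positivity)] at this
  have hκm : κ ^ (2 : ℝ) ≤ κ ^ m := Real.rpow_le_rpow_of_exponent_le hκ1 hm.le
  rw [Real.rpow_two] at hκm
  set K := κ / α with hKd
  have hK0 : 0 < K := by positivity
  have hKα : K * α = κ := by rw [hKd]; field_simp
  set E := κ * s₀ ^ (α - 2) * c₀ ^ 2 + κ * s₀ ^ (α - 1) * D with hE
  have hE0 : 0 ≤ E := by positivity
  set A := A₁ + K * S ^ α + E with hA
  refine ⟨A, fun lam hl0 hl1 u hu hsub x hx => ?_⟩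
  let w : Euc N → ℝ := fun y => A / lam + -K * (-ρ y) ^ α
  have hwc : ContinuousOn w (closure Ω) := by
    refine continuousOn_const.add (continuousOn_const.mul ?_)
    exact (hρ.continuous.neg.continuousOn).rpow_const fun y _ => Or.inr hα0.le
  have hsup : SCSuper Ω m lam f w := by
    intro φ hφ y hy hmin
    by_cases hyΩ : y ∈ Ω
    · have hρy : ρ y < 0 := (hin y).mp hyΩ
      obtain ⟨d1, d2⟩ := barrier_derivs (K := K) (α := α) hρy
      have d1' : ∀ᶠ t in 𝓝 (ρ y), HasDerivAt (fun t : ℝ => -K * (-t) ^ α) (K * α * (-t) ^ (α - 1)) t := by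
        filter_upwards [gt_mem_nhds hρy] with t ht using (barrier_derivs ht).1
      have hwC : ContDiffAt ℝ 2 (fun y => -K * (-ρ y) ^ α) y := by
        refine contDiffAt_const.mul ?_
        exact (hρ.contDiffAt.neg).rpow_const_of_ne (ne_of_gt (by linarith : (0:ℝ) < -ρ y))
      have hwC' : ContDiffAt ℝ 2 w y := contDiffAt_const.add hwC
      have hmax : IsLocalMax (fun z => φ z - w z) y := by
        have h1 : ∀ᶠ z in 𝓝[closure Ω] y, w y - φ y ≤ w z - φ z := hmin
        rw [nhdsWithin_eq_nhds.mpr (mem_of_superset (hO.mem_nhds hyΩ) subset_closure)] at h1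
        filter_upwards [h1] with z hz
        linarith
      obtain ⟨t1, t2⟩ := touch hφ.contDiffAt hwC' hmax
      have gw : gradient w y = (K * α * (-ρ y) ^ (α - 1)) • gradient ρ y := by
        rw [gradient_add (by fun_prop) (hwC.differentiableAt (by norm_num)), gradient_const', zero_add,
          gradient_comp (h := fun t : ℝ => -K * (-t) ^ α) (hρ.differentiable (by norm_num) y) d1]
      have lw : lapl w y = K * α * (1 - α) * (-ρ y) ^ (α - 2) * ‖gradient ρ y‖ ^ 2
          + K * α * (-ρ y) ^ (α - 1) * lapl ρ y := by
        rw [lapl_add contDiffAt_const hwC, lapl_const, zero_add,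
          lapl_comp (h := fun t : ℝ => -K * (-t) ^ α) hρ.contDiffAt d1' d2]
      set s := -ρ y with hs
      have hs0 : 0 < s := by linarith
      have hsS : s ≤ S := by
        have := (abs_le.mp (hS y hy)).1; linarith
      have hDy := abs_le.mp (hD y hy)
      have hfy := (abs_le.mp (hA₁ y hy)).2
      have hp1 : 0 < s ^ (α - 1) := by positivity
      have hp2 : 0 < s ^ (α - 2) := by positivity
      have hps : s ^ (α - 1) = s ^ (α - 2) * s := by
        nth_rewrite 3 [← Real.rpow_one s]
        rw [← Real.rpow_add hs0]; congr 1; ring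
      have gm : ‖gradient w y‖ ^ m = κ ^ m * s ^ (α - 2) * ‖gradient ρ y‖ ^ m := by
        rw [gw, hKα, norm_smul, Real.norm_eq_abs, abs_of_pos (by positivity),
          Real.mul_rpow (by positivity) (norm_nonneg _), Real.mul_rpow hκ0.le hp1.le,
          ← Real.rpow_mul hs0.le, hαm]
      rw [t1]
      rw [hKα] at lw
      have hwy : lam * w y = A - lam * (K * s ^ α) := by
        simp only [w]; rw [← hs]; field_simp; ring
      have hsα : s ^ α ≤ S ^ α := Real.rpow_le_rpow hs0.le hsS hα0.le
      have hlK : lam * (K * s ^ α) ≤ K * S ^ α := by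
        have a1 : 0 ≤ K * s ^ α := by positivity
        have a2 : K * s ^ α ≤ K * S ^ α := mul_le_mul_of_nonneg_left hsα hK0.le
        have a3 : lam * (K * s ^ α) ≤ 1 * (K * s ^ α) := mul_le_mul_of_nonneg_right hl1.le a1
        linarith
      suffices hmain : -E ≤ -lapl w y + ‖gradient w y‖ ^ m by
        rw [hwy, hA]; linarith
      have b1 : κ * s ^ (α - 1) * lapl ρ y ≤ κ * s ^ (α - 1) * D :=
        mul_le_mul_of_nonneg_left hDy.2 (by positivity)
      have b2 : κ * (1 - α) * s ^ (α - 2) * ‖gradient ρ y‖ ^ 2 ≤ κ * s ^ (α - 2) * ‖gradient ρ y‖ ^ 2 := by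
        have : (1 - α) * (κ * s ^ (α - 2) * ‖gradient ρ y‖ ^ 2) ≤ 1 * (κ * s ^ (α - 2) * ‖gradient ρ y‖ ^ 2) :=
          mul_le_mul_of_nonneg_right (by linarith) (by positivity)
        linarith
      rw [lw, gm]
      rcases le_or_gt ‖gradient ρ y‖ c₀ with hcase | hcase
      · have hss := hdic y hy hcase
        have e1 : s ^ (α - 1) ≤ s₀ ^ (α - 1) :=
          Real.rpow_le_rpow_of_nonpos hs₀ hss (by linarith)
        have e2 : s ^ (α - 2) ≤ s₀ ^ (α - 2) :=
          Real.rpow_le_rpow_of_nonpos hs₀ hss (by linarith)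
        have e3 : ‖gradient ρ y‖ ^ 2 ≤ c₀ ^ 2 := pow_le_pow_left₀ (norm_nonneg _) hcase 2
        have e4 : κ * s ^ (α - 2) * ‖gradient ρ y‖ ^ 2 ≤ κ * s₀ ^ (α - 2) * c₀ ^ 2 := by gcongr
        have e5 : κ * s ^ (α - 1) * D ≤ κ * s₀ ^ (α - 1) * D := by gcongr
        have e6 : 0 ≤ κ ^ m * s ^ (α - 2) * ‖gradient ρ y‖ ^ m := by positivity
        rw [hE]; linarith
      · have hg0 : 0 < ‖gradient ρ y‖ := hc₀.trans hcase
        set G := ‖gradient ρ y‖ with hG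
        have e1 : G ^ m = G ^ (m - 2) * G ^ 2 := by
          rw [← Real.rpow_natCast G 2, ← Real.rpow_add hg0]; congr 1; push_cast; ring
        have e2 : c₀ ^ (m - 2) ≤ G ^ (m - 2) := Real.rpow_le_rpow hc₀.le hcase.le (by linarith)
        have e3 : κ * Q * G ^ 2 ≤ κ ^ m * G ^ m := by
          rw [e1]
          have : κ * Q ≤ κ ^ m * G ^ (m - 2) := by
            calc κ * Q ≤ κ * (κ * c₀ ^ (m - 2)) := mul_le_mul_of_nonneg_left hκQ hκ0.le
              _ = κ ^ 2 * c₀ ^ (m - 2) := by ring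
              _ ≤ κ ^ m * G ^ (m - 2) := by gcongr
          calc κ * Q * G ^ 2 ≤ κ ^ m * G ^ (m - 2) * G ^ 2 := mul_le_mul_of_nonneg_right this (sq_nonneg _)
            _ = _ := by ring
        have e4 : S * D ≤ (S * D / c₀ ^ 2) * G ^ 2 := by
          have a : c₀ ^ 2 ≤ G ^ 2 := pow_le_pow_left₀ hc₀.le hcase.le 2
          calc S * D = (S * D / c₀ ^ 2) * c₀ ^ 2 := by field_simp
            _ ≤ _ := mul_le_mul_of_nonneg_left a (by positivity)
        have e5 : κ * s ^ (α - 1) * D ≤ s ^ (α - 2) * (κ * ((S * D / c₀ ^ 2) * G ^ 2)) := by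
          rw [hps]
          have : s * D ≤ (S * D / c₀ ^ 2) * G ^ 2 := (mul_le_mul_of_nonneg_right hsS hD0).trans e4
          calc κ * (s ^ (α - 2) * s) * D = s ^ (α - 2) * (κ * (s * D)) := by ring
            _ ≤ _ := by gcongr
        have e6 := mul_le_mul_of_nonneg_left e3 hp2.le
        have e7 : s ^ (α - 2) * (κ * Q * G ^ 2) = κ * s ^ (α - 2) * G ^ 2
          + s ^ (α - 2) * (κ * ((S * D / c₀ ^ 2) * G ^ 2)) := by rw [hQ]; ring
        have e8 : s ^ (α - 2) * (κ ^ m * G ^ m) = κ ^ m * s ^ (α - 2) * G ^ m := by ring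
        linarith
    · exfalso
      have hρy : ρ y = 0 := by
        have h1 := hcl y hy
        rcases h1.lt_or_eq with h | h
        · exact absurd ((hin y).mpr h) hyΩ
        · exact h
      have hyf : y ∈ frontier Ω := by rw [hfr]; exact hρy
      have hgy : gradient ρ y ≠ 0 := hg y hyf
      set g := gradient ρ y with hgdef
      have hg0 : 0 < ‖g‖ := norm_pos_iff.mpr hgy
      -- decay of ρ in direction -g
      have hl : HasDerivAt (fun t : ℝ => y + t • (-g)) (-g) 0 := by
        simpa using ((hasDerivAt_id (0 : ℝ)).smul_const (-g)).const_add y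
      have hd : HasDerivAt (fun t : ℝ => ρ (y + t • (-g))) (fderiv ℝ ρ y (-g)) 0 := by
        have h1 : HasFDerivAt ρ (fderiv ℝ ρ y) (y + (0 : ℝ) • (-g)) := by
          simpa using (hρ.differentiable (by norm_num) y).hasFDerivAt
        exact h1.comp_hasDerivAt 0 hl
      rw [← inner_gradient, ← hgdef, inner_neg_right, real_inner_self_eq_norm_sq] at hd
      have ho := hd.isLittleO.def (c := ‖g‖ ^ 2 / 2) (by positivity)
      have hdec : ∀ᶠ t : ℝ in 𝓝[>] 0, ‖g‖ ^ 2 / 2 * t ≤ -ρ (y + t • (-g)) := by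
        have := ho.filter_mono (nhdsWithin_le_nhds (s := Ioi (0 : ℝ)))
        filter_upwards [this, self_mem_nhdsWithin] with t ht ht0
        have ht0' : (0 : ℝ) < t := ht0
        simp only [zero_smul, add_zero, sub_zero, smul_eq_mul, Real.norm_eq_abs, hρy,
          abs_of_pos ht0'] at ht
        have := (abs_le.mp ht).2
        linarith
      have hmin' : ∀ᶠ t : ℝ in 𝓝[>] 0, y + t • (-g) ∈ closure Ω →
          w y - φ y ≤ w (y + t • (-g)) - φ (y + t • (-g)) := by
        have h1 : ∀ᶠ z in 𝓝 y, z ∈ closure Ω → w y - φ y ≤ w z - φ z :=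
          eventually_nhdsWithin_iff.mp hmin
        have h2 : Tendsto (fun t : ℝ => y + t • (-g)) (𝓝[>] 0) (𝓝 y) := by
          have := hl.continuousAt.tendsto
          simp only [zero_smul, add_zero] at this
          exact this.mono_left nhdsWithin_le_nhds
        exact h2.eventually h1
      refine slope_contra (φ := φ) (x := y) (n := -g) (hφ.differentiable (by norm_num) y)
        (k := K * (‖g‖ ^ 2 / 2) ^ α) (α := α) (by positivity) hα1 ?_
      filter_upwards [hdec, hmin', self_mem_nhdsWithin] with t h1 h2 h3
      have ht0 : (0 : ℝ) < t := h3
      have hpos : 0 < ‖g‖ ^ 2 / 2 * t := by positivity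
      have hmem : y + t • (-g) ∈ Ω := (hin _).mpr (by linarith)
      have h4 := h2 (subset_closure hmem)
      have hwy : w y = A / lam := by
        simp only [w, hρy, neg_zero, Real.zero_rpow hα0.ne', mul_zero, add_zero]
      have h5 : (‖g‖ ^ 2 / 2 * t) ^ α ≤ (-ρ (y + t • (-g))) ^ α := Real.rpow_le_rpow hpos.le h1 hα0.le
      rw [Real.mul_rpow (by positivity) ht0.le] at h5
      have h6 := mul_le_mul_of_nonneg_left h5 hK0.le
      rw [hwy] at h4
      simp only [w] at h4
      linarith
  have hcmp := comparison hO hb h2' hm hl0 hf hu hwc hsub hsup x hx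
  have hwx : w x ≤ A / lam := by
    have := mul_nonneg hK0.le (Real.rpow_nonneg (by linarith [hcl x hx] : 0 ≤ -ρ x) α)
    simp only [w]; linarith
  have := mul_le_mul_of_nonneg_left (hcmp.trans hwx) hl0.le
  rwa [mul_div_cancel₀ _ hl0.ne'] at this

end SC

namespace SC

theorem norm_facts {N : ℕ} {x y : Euc N} (h : x ≠ y) :
    ContDiffAt ℝ 2 (fun z => ‖z - y‖) x ∧ ‖gradient (fun z => ‖z - y‖) x‖ = 1 ∧
    lapl (fun z => ‖z - y‖) x = (N - 1) / ‖x - y‖ := by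
  have hne : x - y ≠ 0 := sub_ne_zero.mpr h
  have hpos : 0 < ‖x - y‖ := norm_pos_iff.mpr hne
  have hc : ContDiffAt ℝ 2 (fun z => ‖z - y‖) x :=
    (contDiffAt_id.sub contDiffAt_const).norm ℝ hne
  have d1 : ∀ t : ℝ, HasDerivAt (fun t : ℝ => t ^ 2) (2 * t) t := fun t => by
    simpa using hasDerivAt_pow 2 t
  have d2 : ∀ t : ℝ, HasDerivAt (fun t : ℝ => 2 * t) 2 t := fun t => by
    simpa using (hasDerivAt_id t).const_mul (2:ℝ)
  have g := gradient_comp (h := fun t : ℝ => t ^ 2) (hc.differentiableAt (by norm_num)) (d1 _)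
  have l := lapl_comp (h := fun t : ℝ => t ^ 2) hc (Eventually.of_forall d1) (d2 _)
  rw [gradient_sq] at g
  rw [lapl_sq] at l
  have hn : ‖gradient (fun z => ‖z - y‖) x‖ = 1 := by
    have := congrArg norm g
    rw [norm_smul, norm_smul, Real.norm_eq_abs, Real.norm_eq_abs, abs_of_pos (by positivity : (0:ℝ) < 2),
      abs_of_pos (by positivity)] at this
    have h2 : 2 * ‖x - y‖ * (‖gradient (fun z => ‖z - y‖) x‖ - 1) = 0 := by linarith
    rcases mul_eq_zero.mp h2 with h3 | h3
    · linarith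
    · linarith
  refine ⟨hc, hn, ?_⟩
  rw [hn] at l
  rw [eq_div_iff hpos.ne']
  linarith

theorem ball_derivs {K α r s : ℝ} (hs : 0 < s) (hr : s < r) :
    HasDerivAt (fun t : ℝ => K * (r ^ α - (r - t) ^ α + t ^ α))
      (K * α * ((r - s) ^ (α - 1) + s ^ (α - 1))) s ∧
    HasDerivAt (fun t : ℝ => K * α * ((r - t) ^ (α - 1) + t ^ (α - 1)))
      (K * α * (1 - α) * ((r - s) ^ (α - 2) - s ^ (α - 2))) s := by
  have hn : HasDerivAt (fun t : ℝ => r - t) (-1) s := by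
    simpa using (hasDerivAt_id s).const_sub r
  have hi : HasDerivAt (fun t : ℝ => t) 1 s := hasDerivAt_id s
  constructor
  · have a := (hn.rpow_const (p := α) (Or.inl (by linarith))).const_sub (r ^ α)
    have b := (hi.rpow_const (p := α) (Or.inl (by linarith)))
    have := (a.add b).const_mul K
    have e : K * α * ((r - s) ^ (α - 1) + s ^ (α - 1)) =
      K * (-(-1 * α * (r - s) ^ (α - 1)) + 1 * α * s ^ (α - 1)) := by ring
    rw [e]; exact this
  · have a := (hn.rpow_const (p := α - 1) (Or.inl (by linarith)))
    have b := (hi.rpow_const (p := α - 1) (Or.inl (by linarith)))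
    have := (a.add b).const_mul (K * α)
    have e : K * α * (1 - α) * ((r - s) ^ (α - 2) - s ^ (α - 2)) =
      K * α * (-1 * (α - 1) * (r - s) ^ (α - 1 - 1) + 1 * (α - 1) * s ^ (α - 1 - 1)) := by
      rw [show α - 1 - 1 = α - 2 by ring]; ring
    rw [e]; exact this

set_option maxHeartbeats 1000000 in
theorem ball_smooth (N : ℕ) {m : ℝ} (hm : 2 < m) (C₀ : ℝ) {R : ℝ} (hR : 0 < R) :
    ∃ K : ℝ, 0 < K ∧ ∀ (U : Euc N → ℝ) (y : Euc N) (r : ℝ), ContDiff ℝ 2 U → 0 < r → r ≤ R →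
      (∀ x ∈ closedBall y r, -lapl U x + ‖gradient U x‖ ^ m ≤ C₀) →
      ∀ x ∈ closedBall y r, U x ≤ U y + K * ‖x - y‖ ^ ((m - 2) / (m - 1)) := by
  obtain ⟨hα0, hα1, hαm, hαm1⟩ := alpha_facts hm
  set α := (m - 2) / (m - 1) with hα
  set β := R ^ (α - 1) with hβ
  have hβ0 : 0 < β := Real.rpow_pos_of_pos hR _
  set κ : ℝ := N + 2 + |C₀| / β ^ m with hκ
  have hκ1 : 1 ≤ κ := by
    have : 0 ≤ |C₀| / β ^ m := by positivity
    have : (0:ℝ) ≤ N := by positivity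
    linarith
  have hκ0 : 0 < κ := by linarith
  have hκm : κ ^ (2 : ℝ) ≤ κ ^ m := Real.rpow_le_rpow_of_exponent_le hκ1 hm.le
  rw [Real.rpow_two] at hκm
  set K := κ / α with hKd
  have hK0 : 0 < K := by positivity
  have hKα : K * α = κ := by rw [hKd]; field_simp
  refine ⟨2 * K, by positivity, fun U y r hU hr hrR hsub x hx => ?_⟩
  let h : ℝ → ℝ := fun t => K * (r ^ α - (r - t) ^ α + t ^ α)
  let w : Euc N → ℝ := fun z => h ‖z - y‖
  have hh : Continuous h := by
    refine continuous_const.mul ((continuous_const.sub ?_).add ?_)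
    · exact (continuous_const.sub continuous_id).rpow_const fun _ => Or.inr hα0.le
    · exact continuous_id.rpow_const fun _ => Or.inr hα0.le
  have hw : Continuous w := hh.comp (by fun_prop)
  have hw0 : w y = 0 := by simp [w, h, Real.zero_rpow hα0.ne']
  have hcp : IsCompact (closedBall y r) := isCompact_closedBall y r
  obtain ⟨z, hz, hmax⟩ := hcp.exists_isMaxOn ⟨y, mem_closedBall_self hr.le⟩
    (hU.continuous.sub hw).continuousOn
  have hmax' : ∀ x ∈ closedBall y r, U x - w x ≤ U z - w z := hmax
  have hzr : ‖z - y‖ ≤ r := by rw [← dist_eq_norm]; exact hz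
  have hzy : z = y := by
    by_contra hne
    have hpos : 0 < ‖z - y‖ := norm_pos_iff.mpr (sub_ne_zero.mpr hne)
    rcases hzr.lt_or_eq with hlt | heq
    · obtain ⟨hc, hg, hl⟩ := norm_facts hne
      obtain ⟨d1, d2⟩ := ball_derivs (K := K) (α := α) hpos hlt
      have d1' : ∀ᶠ t in 𝓝 ‖z - y‖, HasDerivAt h (K * α * ((r - t) ^ (α - 1) + t ^ (α - 1))) t := by
        filter_upwards [gt_mem_nhds hlt, lt_mem_nhds hpos] with t h1 h2 using (ball_derivs h2 h1).1
      have gw : gradient w z = _ := gradient_comp (h := h) (hc.differentiableAt (by norm_num)) d1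
      have lw : lapl w z = _ := lapl_comp (h := h) hc d1' d2
      have hwC : ContDiffAt ℝ 2 w z := by
        have h1 : ContDiffAt ℝ 2 (fun z : Euc N => (r - ‖z - y‖) ^ α) z :=
          (contDiffAt_const.sub hc).rpow_const_of_ne (ne_of_gt (by linarith : (0:ℝ) < r - ‖z - y‖))
        have h2 : ContDiffAt ℝ 2 (fun z : Euc N => ‖z - y‖ ^ α) z :=
          hc.rpow_const_of_ne hpos.ne'
        exact contDiffAt_const.mul ((contDiffAt_const.sub h1).add h2)
      have hlm : IsLocalMax (fun z => U z - w z) z := by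
        have : closedBall y r ∈ 𝓝 z := by
          refine mem_of_superset (isOpen_ball.mem_nhds ?_) ball_subset_closedBall
          rw [mem_ball, dist_eq_norm]; exact hlt
        filter_upwards [this] with q hq using hmax' q hq
      obtain ⟨t1, t2⟩ := touch hU.contDiffAt hwC hlm
      have hs := hsub z hz
      rw [t1, gw, norm_smul, hg, mul_one, hKα] at hs
      set s := ‖z - y‖ with hsd
      set A := (r - s) ^ (α - 1) with hA
      set B := s ^ (α - 1) with hB
      have hrs : 0 < r - s := by linarith
      have hA0 : 0 < A := Real.rpow_pos_of_pos hrs _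
      have hB0 : 0 < B := Real.rpow_pos_of_pos hpos _
      have hAm : (r - s) ^ (α - 2) = A ^ m := by rw [hA, ← Real.rpow_mul hrs.le, hαm]
      have hBm : s⁻¹ = B ^ (m - 1) := by rw [hB, ← Real.rpow_mul hpos.le, hαm1, Real.rpow_neg_one]
      rw [Real.norm_eq_abs, abs_of_pos (by positivity), Real.mul_rpow hκ0.le (by positivity)] at hs
      rw [hg, hl, hKα, hAm] at lw
      have b1 : A ^ m ≤ (A + B) ^ m := Real.rpow_le_rpow hA0.le (by linarith) (by linarith)
      have b2 : (A + B) * ((N - 1) / s) ≤ N * (A + B) ^ m := by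
        have c1 : B ^ (m - 1) ≤ (A + B) ^ (m - 1) := Real.rpow_le_rpow hB0.le (by linarith) (by linarith)
        have c2 : (A + B) ^ m = (A + B) * (A + B) ^ (m - 1) := by
          nth_rewrite 2 [← Real.rpow_one (A + B)]
          rw [← Real.rpow_add (by linarith)]; congr 1; ring
        have c3 : ((N : ℝ) - 1) / s ≤ N * B ^ (m - 1) := by
          rw [div_eq_mul_inv, hBm]
          exact mul_le_mul_of_nonneg_right (by linarith) (by positivity)
        rw [c2]
        calc (A + B) * ((N - 1) / s) ≤ (A + B) * (N * (A + B) ^ (m - 1)) := by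
              apply mul_le_mul_of_nonneg_left _ (by positivity)
              exact c3.trans (mul_le_mul_of_nonneg_left c1 (by positivity))
          _ = _ := by ring
      have b3 : κ * (1 - α) * (A ^ m - s ^ (α - 2)) ≤ κ * (A + B) ^ m := by
        have c1 : 0 < s ^ (α - 2) := Real.rpow_pos_of_pos hpos _
        have c2 : 0 < A ^ m := Real.rpow_pos_of_pos hA0 _
        calc κ * (1 - α) * (A ^ m - s ^ (α - 2)) ≤ κ * (1 - α) * A ^ m := by
              apply mul_le_mul_of_nonneg_left _ (mul_nonneg hκ0.le (by linarith)); linarith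
          _ ≤ κ * 1 * (A + B) ^ m := by
              apply mul_le_mul _ b1 c2.le (by positivity)
              apply mul_le_mul_of_nonneg_left _ hκ0.le; linarith
          _ = _ := by ring
      have b4 := mul_le_mul_of_nonneg_left b2 hκ0.le
      have b5 : β ^ m ≤ (A + B) ^ m := by
        apply Real.rpow_le_rpow hβ0.le _ (by linarith)
        have : β ≤ A := Real.rpow_le_rpow_of_nonpos hrs (by linarith) (by linarith)
        linarith
      have hβm : 0 < β ^ m := Real.rpow_pos_of_pos hβ0 _
      set T := (A + B) ^ m with hT
      have hTp : 0 < T := hβm.trans_le b5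
      have b6 : κ ^ 2 * T ≤ κ ^ m * T := mul_le_mul_of_nonneg_right hκm hTp.le
      have b7 : |C₀| + β ^ m ≤ (κ - N - 1) * T := by
        have e : |C₀| + β ^ m = (κ - N - 1) * β ^ m := by rw [hκ]; field_simp; ring
        rw [e]; apply mul_le_mul_of_nonneg_left b5
        rw [hκ]; have : 0 ≤ |C₀| / β ^ m := by positivity
        linarith
      have b8 : (κ - N - 1) * T ≤ κ * ((κ - N - 1) * T) := by
        have : 0 ≤ (κ - N - 1) * T := by
          have := abs_nonneg C₀; linarith
        have := mul_le_mul_of_nonneg_right hκ1 this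
        linarith
      have b9 := le_abs_self C₀
      simp only [one_pow, mul_one] at lw
      have b10 : κ * ((κ - N - 1) * T) = κ ^ 2 * T - κ * T - κ * (N * T) := by ring
      have b11 : κ * (A + B) * ((N - 1) / s) = κ * ((A + B) * ((N - 1) / s)) := by ring
      linarith
    · refine slope_contra (φ := U) (x := z) (n := -(z - y)) (hU.differentiable (by norm_num) z)
        (k := K * r ^ α) (α := α) (by positivity) hα1 ?_
      filter_upwards [self_mem_nhdsWithin, mem_nhdsWithin_of_mem_nhds (gt_mem_nhds (one_pos : (0:ℝ) < 1))] with t h1 h2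
      have ht0 : (0:ℝ) < t := h1
      have e : z + t • -(z - y) - y = (1 - t) • (z - y) := by module
      have en : ‖z + t • -(z - y) - y‖ = r - r * t := by
        rw [e, norm_smul, Real.norm_eq_abs, abs_of_pos (by linarith), heq]; ring
      have hmem : z + t • -(z - y) ∈ closedBall y r := by
        rw [mem_closedBall, dist_eq_norm, en]; nlinarith
      have := hmax' _ hmem
      have e1 : w z = K * (r ^ α + r ^ α) := by simp [w, h, heq, Real.zero_rpow hα0.ne']
      have e2 : w (z + t • -(z - y)) = K * (r ^ α - r ^ α * t ^ α + (r - r * t) ^ α) := by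
        simp only [w, h]; rw [en, ← Real.mul_rpow hr.le ht0.le]; congr 4; ring
      rw [e1, e2] at this
      have e3 : (r - r * t) ^ α ≤ r ^ α := Real.rpow_le_rpow (by nlinarith) (by nlinarith) hα0.le
      have e4 := mul_le_mul_of_nonneg_left e3 hK0.le
      nlinarith
  have h1 := hmax' x hx
  rw [hzy, hw0] at h1
  have hxr : ‖x - y‖ ≤ r := by rw [← dist_eq_norm]; exact hx
  have h2 : r ^ α ≤ (r - ‖x - y‖) ^ α + ‖x - y‖ ^ α := by
    have := Real.rpow_add_le_add_rpow (sub_nonneg.mpr hxr) (norm_nonneg (x - y)) hα0.le hα1.le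
    simpa using this
  have h3 : w x ≤ 2 * K * ‖x - y‖ ^ α := by
    simp only [w, h]
    have : r ^ α - (r - ‖x - y‖) ^ α + ‖x - y‖ ^ α ≤ 2 * ‖x - y‖ ^ α := by linarith
    have := mul_le_mul_of_nonneg_left this hK0.le
    linarith
  linarith

end SC

namespace SC

theorem ball_visc (N : ℕ) {m : ℝ} (hm : 2 < m) (C₀ : ℝ) {R : ℝ} (hR : 0 < R) :
    ∃ K : ℝ, 0 < K ∧ ∀ (O S : Set (Euc N)) (u F : Euc N → ℝ) (y : Euc N) (r : ℝ), IsOpen O →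
      IsCompact S → O ⊆ S → ContinuousOn u S → ContinuousOn F O → HJSub O m F u →
      (∀ x ∈ O, F x ≤ C₀) → 0 < r → r ≤ R → closedBall y r ⊆ O →
      ∀ x ∈ closedBall y r, u x ≤ u y + K * ‖x - y‖ ^ ((m - 2) / (m - 1)) := by
  obtain ⟨K, hK0, hK⟩ := ball_smooth N hm C₀ hR
  refine ⟨K, hK0, fun O S u F y r hO hS hOS hu hF hsub hFC hr hrR hball x hx => ?_⟩
  refine le_of_forall_pos_le_add fun e he => ?_
  obtain ⟨δ, hδ, hδO⟩ := (isCompact_closedBall y r).exists_cthickening_subset_open hO hball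
  have huc := hS.uniformContinuousOn_of_continuous hu
  obtain ⟨δ', hδ', huc⟩ := Metric.uniformContinuousOn_iff.mp huc (e / 2) (by positivity)
  set ε := min δ (δ' / 2) with hε
  have hε0 : 0 < ε := by positivity
  obtain ⟨U, hU, hUx⟩ := mollify hO hS hOS hm hu hF hsub hε0
  have hsubO : ∀ p ∈ closedBall y r, closedBall p ε ⊆ O := fun p hp =>
    ((closedBall_subset_cthickening hp ε).trans
      (cthickening_mono (min_le_left _ _) _)).trans hδO
  have hclose : ∀ p ∈ closedBall y r, ∀ q ∈ closedBall p ε, |u q - u p| < e / 2 := by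
    intro p hp q hq
    have h1 : q ∈ S := hOS (hsubO p hp hq)
    have h2 : p ∈ S := hOS (hball hp)
    have h3 : dist q p < δ' := by
      have : dist q p ≤ ε := hq
      have := min_le_right δ (δ' / 2)
      linarith
    have := huc q h1 p h2 h3
    rwa [Real.dist_eq] at this
  have hlo : ∀ p ∈ closedBall y r, u p - e / 2 ≤ U p := fun p hp =>
    (hUx p (hsubO p hp)).2.2 _ fun q hq => by
      have := abs_lt.mp (hclose p hp q hq); linarith
  have hhi : ∀ p ∈ closedBall y r, U p ≤ u p + e / 2 := fun p hp =>
    (hUx p (hsubO p hp)).2.1 _ fun q hq => by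
      have := abs_lt.mp (hclose p hp q hq); linarith
  have hy : y ∈ closedBall y r := mem_closedBall_self hr.le
  have := hK U y r hU hr hrR (fun p hp => (hUx p (hsubO p hp)).1 _ fun q hq => hFC q (hsubO p hp hq)) x hx
  linarith [hlo x hx, hhi y hy]

theorem equi {N : ℕ} {Ω : Set (Euc N)} (hO : IsOpen Ω) (hb : Bornology.IsBounded Ω)
    (h2 : HasC2Boundary Ω) {m : ℝ} (hm : 2 < m) (C₀ : ℝ) {z : Euc N} (hz : z ∈ closure Ω) :
    ∃ t₀ c M : ℝ, 0 < t₀ ∧ 0 < c ∧ 0 < M ∧ ∀ u F : Euc N → ℝ, ContinuousOn u (closure Ω) →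
      ContinuousOn F Ω → HJSub Ω m F u → (∀ x ∈ Ω, F x ≤ C₀) →
      ∀ t, 0 < t → t ≤ t₀ → ∀ x ∈ closure Ω, dist x z ≤ c * t →
        |u x - u z| ≤ M * t ^ ((m - 2) / (m - 1)) := by
  obtain ⟨n, c, t₀, r₀, hc, ht₀, hr₀, hgeo⟩ := geom hO h2 hz
  obtain ⟨K, hK0, hK⟩ := ball_visc N hm C₀ (R := c * t₀ / 2) (by positivity)
  obtain ⟨hα0, hα1, -, -⟩ := alpha_facts hm
  set α := (m - 2) / (m - 1) with hα
  set K₁ := K * (c / 2) ^ α with hK₁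
  have hK₁0 : 0 < K₁ := by positivity
  obtain ⟨θ, hθ0, hθ1, hθn⟩ : ∃ θ : ℝ, 0 < θ ∧ θ < 1 ∧ (1 - θ) * ‖n‖ ≤ c / 2 := by
    refine ⟨1 - min (1 / 2) (c / (2 * (‖n‖ + 1))), ?_, ?_, ?_⟩
    · have := min_le_left (1 / 2) (c / (2 * (‖n‖ + 1))); linarith
    · have : 0 < min (1 / 2) (c / (2 * (‖n‖ + 1))) := by positivity
      linarith
    · have h := min_le_right (1 / 2) (c / (2 * (‖n‖ + 1)))
      rw [sub_sub_cancel]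
      calc _ ≤ c / (2 * (‖n‖ + 1)) * (‖n‖ + 1) :=
            mul_le_mul h (by linarith) (norm_nonneg _) (by positivity)
        _ = c / 2 := by field_simp
  have hθα : θ ^ α < 1 := Real.rpow_lt_one hθ0.le hθ1 hα0
  set G := K₁ / (1 - θ ^ α) with hG
  have hG0 : 0 < G := div_pos hK₁0 (by linarith)
  have hGK : K₁ = G * (1 - θ ^ α) := by
    rw [hG, div_mul_cancel₀]; linarith
  refine ⟨min t₀ (2 * r₀ / c), c / 2, 2 * G + K₁, by positivity, by positivity, by positivity,
    fun u F hu hF hsub hFC t ht htt x hx hxz => ?_⟩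
  have htt₀ : t ≤ t₀ := htt.trans (min_le_left _ _)
  have htr : c / 2 * t ≤ r₀ := by
    have := htt.trans (min_le_right _ _)
    rw [le_div_iff₀ hc] at this; linarith
  have est : ∀ x ∈ closure Ω, dist x z ≤ r₀ → ∀ t, 0 < t → t ≤ t₀ → ∀ q, dist q (x + t • n) ≤ c / 2 * t →
      |u q - u (x + t • n)| ≤ K₁ * t ^ α := by
    intro x hx hxr t ht htt q hq
    have hbig := hgeo x hx hxr t ht htt
    have e1 : c / 2 * t ≤ c * t₀ / 2 := by nlinarith
    have hp0 : 0 < c / 2 * t := by positivity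
    have hb1 : closedBall (x + t • n) (c / 2 * t) ⊆ Ω :=
      (closedBall_subset_closedBall (by linarith)).trans hbig
    have hb2 : closedBall q (c / 2 * t) ⊆ Ω := by
      refine (closedBall_subset_closedBall' ?_).trans hbig
      linarith
    have k1 := hK Ω (closure Ω) u F _ _ hO hb.isCompact_closure subset_closure hu hF hsub hFC hp0 e1 hb1 q hq
    have k2 := hK Ω (closure Ω) u F _ _ hO hb.isCompact_closure subset_closure hu hF hsub hFC hp0 e1 hb2
      (x + t • n) (by rw [mem_closedBall, dist_comm]; exact hq)
    rw [← dist_eq_norm] at k1 k2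
    rw [dist_comm] at k2
    have k3 : K * dist q (x + t • n) ^ α ≤ K₁ * t ^ α := by
      rw [hK₁, mul_assoc, ← Real.mul_rpow (by positivity) ht.le]
      apply mul_le_mul_of_nonneg_left _ hK0.le
      exact Real.rpow_le_rpow dist_nonneg hq hα0.le
    rw [abs_le]; constructor <;> linarith
  have tele : ∀ x ∈ closure Ω, dist x z ≤ r₀ → |u x - u (x + t • n)| ≤ G * t ^ α := by
    intro x hx hxr
    have hs : ∀ k : ℕ, 0 < θ ^ k * t ∧ θ ^ k * t ≤ t := fun k =>
      ⟨by positivity, by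
        have := pow_le_one₀ (n := k) hθ0.le hθ1.le
        nlinarith⟩
    have hk : ∀ k : ℕ, |u (x + (θ ^ k * t) • n) - u (x + t • n)| ≤ G * (t ^ α - (θ ^ k * t) ^ α) := by
      intro k
      induction k with
      | zero => simp
      | succ k ih =>
        have h1 := est x hx hxr (θ ^ k * t) (hs k).1 ((hs k).2.trans htt₀) (x + (θ ^ (k + 1) * t) • n) (by
          rw [dist_eq_norm]
          have : x + (θ ^ (k + 1) * t) • n - (x + (θ ^ k * t) • n) = (-((1 - θ) * (θ ^ k * t))) • n := by
            rw [pow_succ]; module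
          rw [this, norm_smul, norm_neg, Real.norm_eq_abs, abs_of_nonneg
            (mul_nonneg (by linarith) (hs k).1.le)]
          have := mul_le_mul_of_nonneg_right hθn (hs k).1.le
          linarith)
        have e : (θ ^ (k + 1) * t) ^ α = θ ^ α * (θ ^ k * t) ^ α := by
          rw [← Real.mul_rpow hθ0.le (hs k).1.le]; congr 1; ring
        have e2 : K₁ * (θ ^ k * t) ^ α = G * (θ ^ k * t) ^ α - G * (θ ^ α * (θ ^ k * t) ^ α) := by
          rw [hGK]; ring
        have := abs_sub_le (u (x + (θ ^ (k + 1) * t) • n)) (u (x + (θ ^ k * t) • n)) (u (x + t • n))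
        rw [e]
        linarith
    have hlim : Tendsto (fun k : ℕ => u (x + (θ ^ k * t) • n)) atTop (𝓝 (u x)) := by
      have h1 : Tendsto (fun k : ℕ => x + (θ ^ k * t) • n) atTop (𝓝 x) := by
        have := (((tendsto_pow_atTop_nhds_zero_of_lt_one hθ0.le hθ1).mul_const t).smul_const n).const_add x
        simpa using this
      have h2 : Tendsto (fun k : ℕ => x + (θ ^ k * t) • n) atTop (𝓝[closure Ω] x) := by
        refine tendsto_nhdsWithin_iff.mpr ⟨h1, Eventually.of_forall fun k => subset_closure ?_⟩
        exact hgeo x hx hxr _ (hs k).1 ((hs k).2.trans htt₀)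
          (mem_closedBall_self (mul_nonneg hc.le (hs k).1.le))
      exact (hu x hx).tendsto.comp h2
    refine le_of_tendsto (hlim.sub_const _).abs (Eventually.of_forall fun k => (hk k).trans ?_)
    have : 0 ≤ (θ ^ k * t) ^ α := Real.rpow_nonneg (hs k).1.le _
    nlinarith
  have hxr : dist x z ≤ r₀ := hxz.trans htr
  have hzr : dist z z ≤ r₀ := by rw [dist_self]; exact hr₀.le
  have a1 := tele x hx hxr
  have a2 := tele z hz hzr
  have a3 := est z hz hzr t ht htt₀ (x + t • n) (by simpa using hxz)
  rw [abs_le] at *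
  constructor <;> linarith [a1.1, a1.2, a2.1, a2.2, a3.1, a3.2]

end SC

namespace SC

theorem perturb {N : ℕ} {φ : Euc N → ℝ} (hφ : ContDiff ℝ 2 φ) (x₀ : Euc N) (e c : ℝ) :
    ContDiff ℝ 2 (fun x => φ x + (e * ‖x - x₀‖ ^ 2 + c)) ∧
    gradient (fun x => φ x + (e * ‖x - x₀‖ ^ 2 + c)) x₀ = gradient φ x₀ ∧
    lapl (fun x => φ x + (e * ‖x - x₀‖ ^ 2 + c)) x₀ = lapl φ x₀ + e * (2 * N) := by
  have h1 : ContDiff ℝ 2 (fun x : Euc N => e * ‖x - x₀‖ ^ 2) := contDiff_const.mul (contDiff_sq x₀)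
  have h2 : ContDiff ℝ 2 (fun x : Euc N => e * ‖x - x₀‖ ^ 2 + c) := h1.add contDiff_const
  refine ⟨hφ.add h2, ?_, ?_⟩
  · rw [gradient_add (hφ.differentiable (by norm_num) _) (h2.differentiable (by norm_num) _),
      gradient_add (h1.differentiable (by norm_num) _) (differentiableAt_const _), gradient_const',
      gradient_const_mul e ((contDiff_sq x₀ (n := 2)).differentiable (by norm_num) _), gradient_sq]
    simp
  · rw [lapl_add hφ.contDiffAt h2.contDiffAt, lapl_add h1.contDiffAt contDiffAt_const, lapl_const,
      lapl_const_mul e (contDiff_sq x₀).contDiffAt, lapl_sq]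
    simp

theorem continuous_op {N : ℕ} {φ : Euc N → ℝ} (hφ : ContDiff ℝ 2 φ) {m : ℝ} (hm : 2 < m) :
    Continuous (fun x => -lapl φ x + ‖gradient φ x‖ ^ m) :=
  (continuous_lapl hφ).neg.add
    ((continuous_gradient hφ).norm.rpow_const fun _ => Or.inr (by linarith))

/-- Perron class -/
def PC {N : ℕ} (Ω : Set (Euc N)) (m lam B : ℝ) (f : Euc N → ℝ) (u : Euc N → ℝ) : Prop :=
  ContinuousOn u (closure Ω) ∧ HJSub Ω m (fun y => f y - lam * u y) u ∧ ∀ x ∈ closure Ω, B ≤ u x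

/-- W is the upper envelope of the Perron class -/
def Env {N : ℕ} (Ω : Set (Euc N)) (m lam B : ℝ) (f : Euc N → ℝ) (W : Euc N → ℝ) : Prop :=
  (∀ u, PC Ω m lam B f u → ∀ x ∈ closure Ω, u x ≤ W x) ∧
  ∀ x ∈ closure Ω, ∀ e > 0, ∃ u, PC Ω m lam B f u ∧ W x - e < u x

theorem env_cont {N : ℕ} {Ω : Set (Euc N)} (hO : IsOpen Ω) (hb : Bornology.IsBounded Ω)
    (h2 : HasC2Boundary Ω) {m : ℝ} (hm : 2 < m) {f : Euc N → ℝ} (hf : ContinuousOn f (closure Ω))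
    {lam B : ℝ} (hl : 0 < lam) {W : Euc N → ℝ} (hW : Env Ω m lam B f W) :
    ContinuousOn W (closure Ω) := by
  obtain ⟨A₁, hA₁⟩ := hb.isCompact_closure.exists_bound_of_continuousOn hf
  simp only [Real.norm_eq_abs] at hA₁
  intro z hz
  obtain ⟨t₀, c, M, ht₀, hc, hM, heq⟩ := equi hO hb h2 hm (A₁ - lam * B) hz
  obtain ⟨hα0, -, -, -⟩ := alpha_facts hm
  set α := (m - 2) / (m - 1) with hα
  have key : ∀ t, 0 < t → t ≤ t₀ → ∀ x ∈ closure Ω, dist x z ≤ c * t → |W x - W z| ≤ M * t ^ α := by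
    intro t ht htt x hx hxz
    have h1 : ∀ u, PC Ω m lam B f u → |u x - u z| ≤ M * t ^ α := fun u hu =>
      heq u _ hu.1 ((hf.sub (continuousOn_const.mul hu.1)).mono subset_closure) hu.2.1 (fun y hy => by
        have a := (abs_le.mp (hA₁ y (subset_closure hy))).2
        have b := mul_le_mul_of_nonneg_left (hu.2.2 y (subset_closure hy)) hl.le
        show f y - lam * u y ≤ _
        linarith) t ht htt x hx hxz
    rw [abs_le]; constructor
    · suffices W z ≤ W x + M * t ^ α by linarith
      refine le_of_forall_pos_le_add fun e he => ?_
      obtain ⟨u, hu, hue⟩ := hW.2 z hz e he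
      have := (abs_le.mp (h1 u hu)).1
      linarith [hW.1 u hu x hx]
    · suffices W x ≤ W z + M * t ^ α by linarith
      refine le_of_forall_pos_le_add fun e he => ?_
      obtain ⟨u, hu, hue⟩ := hW.2 x hx e he
      have := (abs_le.mp (h1 u hu)).2
      linarith [hW.1 u hu z hz]
  rw [Metric.continuousWithinAt_iff]
  intro ε hε
  have hpow : Tendsto (fun t : ℝ => M * t ^ α) (𝓝[>] 0) (𝓝 0) := by
    have := ((Real.continuousAt_rpow_const 0 α (Or.inr hα0.le)).tendsto).const_mul M
    rw [Real.zero_rpow hα0.ne', mul_zero] at this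
    exact this.mono_left nhdsWithin_le_nhds
  obtain ⟨t, h1, h3, h4⟩ := ((hpow.eventually (gt_mem_nhds hε)).and
    (((gt_mem_nhds ht₀).filter_mono nhdsWithin_le_nhds).and self_mem_nhdsWithin)).exists
  have ht0 : (0:ℝ) < t := h4
  refine ⟨c * t, by positivity, fun x hx hxz => ?_⟩
  rw [Real.dist_eq]
  exact (key t ht0 (le_of_lt h3) x hx hxz.le).trans_lt h1

theorem env_sub {N : ℕ} {Ω : Set (Euc N)} (hO : IsOpen Ω)
    {m : ℝ} (hm : 2 < m) {f : Euc N → ℝ} (hf : ContinuousOn f (closure Ω))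
    {lam B : ℝ} (hl : 0 < lam) {W : Euc N → ℝ} (hW : Env Ω m lam B f W) :
    HJSub Ω m (fun y => f y - lam * W y) W := by
  intro φ hφ x₀ hx₀ hmax
  by_contra hcon
  push Not at hcon
  have hx₀c := subset_closure hx₀
  set gap := -lapl φ x₀ + ‖gradient φ x₀‖ ^ m - (f x₀ - lam * W x₀) with hgap
  have hgap0 : 0 < gap := by rw [hgap]; linarith
  set e := gap / (4 * (N + 1)) with he
  have he0 : 0 < e := by positivity
  have heN : e * (2 * N) ≤ gap / 2 := by
    have : e * (2 * (N + 1)) = gap / 2 := by rw [he]; field_simp; ring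
    linarith
  obtain ⟨hψ, gψ, lψ⟩ := perturb hφ x₀ e 0
  set ψ : Euc N → ℝ := fun x => φ x + (e * ‖x - x₀‖ ^ 2 + 0) with hψd
  let H : Euc N → ℝ := fun x => (-lapl ψ x + ‖gradient ψ x‖ ^ m) - f x + lam * (W x₀ + ψ x - ψ x₀)
  have hH : ContinuousAt H x₀ := by
    have hfc : ContinuousAt f x₀ := hf.continuousAt (mem_of_superset (hO.mem_nhds hx₀) subset_closure)
    exact ((continuous_op hψ hm).continuousAt.sub hfc).add (continuousAt_const.mul
      ((continuousAt_const.add hψ.continuous.continuousAt).sub continuousAt_const))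
  have hH0 : gap / 2 ≤ H x₀ := by
    simp only [H]; rw [gψ, lψ]; linarith
  have hev : ∀ᶠ x in 𝓝 x₀, x ∈ Ω ∧ W x - φ x ≤ W x₀ - φ x₀ ∧ gap / 4 < H x :=
    (show ∀ᶠ x in 𝓝 x₀, x ∈ Ω from hO.mem_nhds hx₀).and
      ((show ∀ᶠ x in 𝓝 x₀, W x - φ x ≤ W x₀ - φ x₀ from hmax).and (hH.eventually (lt_mem_nhds (by linarith))))
  obtain ⟨r, hr, hball⟩ := nhds_basis_closedBall.mem_iff.mp hev
  have hbΩ : closedBall x₀ r ⊆ Ω := fun x hx => (hball hx).1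
  set δ := min (gap / (4 * lam)) (e * r ^ 2 / 2) with hδ
  have hδ0 : 0 < δ := by positivity
  obtain ⟨u, hu, hux⟩ := hW.2 x₀ hx₀c δ hδ0
  have hxm : x₀ ∈ closedBall x₀ r := mem_closedBall_self hr.le
  obtain ⟨y, hy, hym⟩ := (isCompact_closedBall x₀ r).exists_isMaxOn ⟨x₀, hxm⟩
    ((hu.1.mono (hbΩ.trans subset_closure)).sub hψ.continuous.continuousOn)
  have hym' : ∀ x ∈ closedBall x₀ r, u x - ψ x ≤ u y - ψ y := hym
  obtain ⟨hyΩ, hyW, hyH⟩ := hball hy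
  have h1 := hym' x₀ hxm
  have h2 := hW.1 u hu y (subset_closure hyΩ)
  have hψ0 : ψ x₀ = φ x₀ := by simp [hψd]
  have hψy : ψ y = φ y + e * ‖y - x₀‖ ^ 2 := by simp [hψd]
  have h3 : e * ‖y - x₀‖ ^ 2 < e * r ^ 2 := by
    have : e * ‖y - x₀‖ ^ 2 ≤ δ := by linarith
    have h4 : δ ≤ e * r ^ 2 / 2 := min_le_right _ _
    have : 0 < e * r ^ 2 := by positivity
    linarith
  have h5 : ‖y - x₀‖ < r := by
    have := lt_of_mul_lt_mul_left h3 he0.le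
    exact lt_of_pow_lt_pow_left₀ 2 hr.le this
  have hlm : IsLocalMax (fun x => u x - ψ x) y := by
    have : closedBall x₀ r ∈ 𝓝 y := by
      refine mem_of_superset (isOpen_ball.mem_nhds ?_) ball_subset_closedBall
      rw [mem_ball, dist_eq_norm]; exact h5
    filter_upwards [this] with q hq using hym' q hq
  have h6 := hu.2.1 ψ hψ y hyΩ hlm
  have h7 : W x₀ + ψ y - ψ x₀ - δ ≤ u y := by linarith
  have h8 := mul_le_mul_of_nonneg_left h7 hl.le
  have h9 : lam * δ ≤ gap / 4 := by
    have : δ ≤ gap / (4 * lam) := min_le_left _ _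
    calc lam * δ ≤ lam * (gap / (4 * lam)) := mul_le_mul_of_nonneg_left this hl.le
      _ = gap / 4 := by field_simp
  simp only [H] at hyH
  linarith

open scoped Classical in
theorem env_super {N : ℕ} {Ω : Set (Euc N)} (hO : IsOpen Ω)
    {m : ℝ} (hm : 2 < m) {f : Euc N → ℝ} (hf : ContinuousOn f (closure Ω))
    {lam B : ℝ} (hl : 0 < lam) {W : Euc N → ℝ} (hW : Env Ω m lam B f W)
    (hPW : PC Ω m lam B f W) : SCSuper Ω m lam f W := by
  intro φ hφ x₀ hx₀ hmin
  by_contra hcon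
  push Not at hcon
  set gap := f x₀ - lam * W x₀ - (-lapl φ x₀ + ‖gradient φ x₀‖ ^ m) with hgap
  have hgap0 : 0 < gap := by rw [hgap]; linarith
  set e := gap / (4 * (N + 1)) with he
  have he0 : 0 < e := by positivity
  have heN : e * (2 * N) ≤ gap / 2 := by
    have : e * (2 * (N + 1)) = gap / 2 := by rw [he]; field_simp; ring
    linarith
  obtain ⟨hψ, gψ, lψ⟩ := perturb hφ x₀ (-e) (W x₀ - φ x₀)
  set ψ : Euc N → ℝ := fun x => φ x + (-e * ‖x - x₀‖ ^ 2 + (W x₀ - φ x₀)) with hψd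
  have hψ0 : ψ x₀ = W x₀ := by simp [hψd]
  let H : Euc N → ℝ := fun x => (-lapl ψ x + ‖gradient ψ x‖ ^ m) - f x + lam * ψ x
  have hH : ContinuousWithinAt H (closure Ω) x₀ :=
    ((continuous_op hψ hm).continuousWithinAt.sub (hf x₀ hx₀)).add
      (continuousWithinAt_const.mul hψ.continuous.continuousWithinAt)
  have hH0 : H x₀ ≤ -(gap / 2) := by
    simp only [H]; rw [gψ, lψ, hψ0]; linarith
  have hev : ∀ᶠ x in 𝓝[closure Ω] x₀, W x₀ - φ x₀ ≤ W x - φ x ∧ H x < -(gap / 4) :=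
    (show ∀ᶠ x in 𝓝[closure Ω] x₀, W x₀ - φ x₀ ≤ W x - φ x from hmin).and
      (hH.eventually (gt_mem_nhds (by linarith)))
  rw [eventually_nhdsWithin_iff] at hev
  obtain ⟨r, hr, hball⟩ := nhds_basis_closedBall.mem_iff.mp hev
  set κ := min (gap / (4 * lam)) (e * (r / 2) ^ 2 / 2) with hκ
  have hκ0 : 0 < κ := by positivity
  have hκ1 : lam * κ ≤ gap / 4 := by
    have : κ ≤ gap / (4 * lam) := min_le_left _ _
    calc lam * κ ≤ lam * (gap / (4 * lam)) := mul_le_mul_of_nonneg_left this hl.le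
      _ = gap / 4 := by field_simp
  have hκ2 : κ < e * (r / 2) ^ 2 := by
    have h4 : κ ≤ e * (r / 2) ^ 2 / 2 := min_le_right _ _
    have : 0 < e * (r / 2) ^ 2 := by positivity
    linarith
  let V : Euc N → ℝ := fun x => if dist x x₀ < r then max (W x) (ψ x + κ) else W x
  have hV1 : ∀ x, dist x x₀ < r → V x = max (W x) (ψ x + κ) := fun x hx => by simp [V, hx]
  have hV2 : ∀ x ∈ closure Ω, r / 2 < dist x x₀ → V x = W x := by
    intro x hx hxr
    by_cases h : dist x x₀ < r
    · rw [hV1 x h]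
      apply max_eq_left
      have h1 := (hball (show x ∈ closedBall x₀ r from h.le) hx).1
      have h2 : (r / 2) ^ 2 ≤ ‖x - x₀‖ ^ 2 := by
        rw [← dist_eq_norm]; exact pow_le_pow_left₀ (by positivity) hxr.le 2
      have h3 := mul_le_mul_of_nonneg_left h2 he0.le
      simp only [hψd]; linarith
    · simp [V, h]
  have hVW : ∀ x, W x ≤ V x := by
    intro x
    by_cases h : dist x x₀ < r
    · rw [hV1 x h]; exact le_max_left _ _
    · simp [V, h]
  have hVc : ContinuousOn V (closure Ω) := by
    intro x hx
    by_cases h : dist x x₀ < r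
    · have hev : V =ᶠ[𝓝[closure Ω] x] fun x => max (W x) (ψ x + κ) := by
        have : ∀ᶠ y in 𝓝 x, dist y x₀ < r :=
          (continuous_id.dist continuous_const).continuousAt.eventually (gt_mem_nhds h)
        exact (this.filter_mono nhdsWithin_le_nhds).mono hV1
      have hcw : ContinuousWithinAt (fun x => max (W x) (ψ x + κ)) (closure Ω) x :=
        Filter.Tendsto.max (hPW.1 x hx) ((hψ.continuous.add continuous_const).continuousWithinAt)
      exact hcw.congr_of_eventuallyEq hev (hV1 x h)
    · have hrx : r / 2 < dist x x₀ := by linarith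
      have hev : V =ᶠ[𝓝[closure Ω] x] W := by
        have : ∀ᶠ y in 𝓝 x, r / 2 < dist y x₀ :=
          (continuous_id.dist continuous_const).continuousAt.eventually (lt_mem_nhds hrx)
        filter_upwards [this.filter_mono nhdsWithin_le_nhds, self_mem_nhdsWithin] with y h1 h2
        exact hV2 y h2 h1
      exact (hPW.1 x hx).congr_of_eventuallyEq hev (hV2 x hx hrx)
  have hVP : PC Ω m lam B f V := by
    refine ⟨hVc, ?_, fun x hx => (hPW.2.2 x hx).trans (hVW x)⟩
    intro χ hχ x hx hmax
    have hmax' : ∀ᶠ y in 𝓝 x, V y - χ y ≤ V x - χ x := hmax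
    by_cases hc : V x = W x
    · have : IsLocalMax (fun y => W y - χ y) x := by
        filter_upwards [hmax'] with y hy
        rw [hc] at hy; linarith [hVW y]
      have := hPW.2.1 χ hχ x hx this
      show _ ≤ f x - lam * V x
      rw [hc]; exact this
    · have hd : dist x x₀ < r := by
        by_contra h
        exact hc (hV2 x (subset_closure hx) (by linarith))
      have hVx : V x = ψ x + κ := by
        rw [hV1 x hd] at hc ⊢
        rcases max_choice (W x) (ψ x + κ) with h | h
        · exact absurd h hc
        · exact h
      have hlm : IsLocalMax (fun y => ψ y - χ y) x := by
        have : ∀ᶠ y in 𝓝 x, dist y x₀ < r :=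
          (continuous_id.dist continuous_const).continuousAt.eventually (gt_mem_nhds hd)
        filter_upwards [hmax', this] with y hy hyd
        rw [hVx, hV1 y hyd] at hy
        linarith [le_max_right (W y) (ψ y + κ)]
      obtain ⟨t1, t2⟩ := touch hψ.contDiffAt hχ.contDiffAt hlm
      have hHx := (hball (show x ∈ closedBall x₀ r from hd.le) (subset_closure hx)).2
      show _ ≤ f x - lam * V x
      rw [hVx, ← t1]
      simp only [H] at hHx
      linarith
  have h1 := hW.1 V hVP x₀ hx₀
  rw [hV1 x₀ (by simpa using hr)] at h1
  have h2 := le_max_right (W x₀) (ψ x₀ + κ)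
  linarith

theorem perron {N : ℕ} {Ω : Set (Euc N)} (hO : IsOpen Ω) (hb : Bornology.IsBounded Ω)
    (hne : Ω.Nonempty) (h2 : HasC2Boundary Ω) {m : ℝ} (hm : 2 < m) {f : Euc N → ℝ}
    (hf : ContinuousOn f (closure Ω)) :
    ∃ C : ℝ, 0 < C ∧ ∀ lam, 0 < lam → lam < 1 → ∃ W : Euc N → ℝ, ContinuousOn W (closure Ω) ∧
      HJSub Ω m (fun y => f y - lam * W y) W ∧ SCSuper Ω m lam f W ∧
      ∀ x ∈ closure Ω, |lam * W x| ≤ C := by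
  obtain ⟨A, hA⟩ := upper_bound hO hb hne h2 hm hf
  obtain ⟨A₁, hA₁⟩ := hb.isCompact_closure.exists_bound_of_continuousOn hf
  simp only [Real.norm_eq_abs] at hA₁
  refine ⟨max |A| |A₁| + 1, by positivity, fun lam hl hl1 => ?_⟩
  have hconst : PC Ω m lam (-A₁ / lam) f (fun _ => -A₁ / lam) := by
    refine ⟨continuousOn_const, ?_, fun x _ => le_rfl⟩
    intro φ hφ x hx hmax
    obtain ⟨t1, t2⟩ := touch contDiffAt_const hφ.contDiffAt hmax
    rw [gradient_const'] at t1
    rw [lapl_const] at t2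
    rw [← t1, norm_zero, Real.zero_rpow (by linarith)]
    have := (abs_le.mp (hA₁ x (subset_closure hx))).1
    show _ ≤ f x - lam * (-A₁ / lam)
    rw [mul_div_cancel₀ _ hl.ne']
    linarith
  let W : Euc N → ℝ := fun x => sSup {s | ∃ u, PC Ω m lam (-A₁ / lam) f u ∧ u x = s}
  have hbdd : ∀ x ∈ closure Ω, ∀ u, PC Ω m lam (-A₁ / lam) f u → u x ≤ A / lam := fun x hx u hu => by
    rw [le_div_iff₀ hl, mul_comm]; exact hA lam hl hl1 u hu.1 hu.2.1 x hx
  have hW : Env Ω m lam (-A₁ / lam) f W := by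
    refine ⟨fun u hu x hx => ?_, fun x hx e he => ?_⟩
    · refine le_csSup ⟨A / lam, ?_⟩ ⟨u, hu, rfl⟩
      rintro s ⟨v, hv, rfl⟩; exact hbdd x hx v hv
    · obtain ⟨s, ⟨u, hu, rfl⟩, hs⟩ := exists_lt_of_lt_csSup
        (s := {s | ∃ u, PC Ω m lam (-A₁ / lam) f u ∧ u x = s}) ⟨_, _, hconst, rfl⟩
        (show W x - e < W x by linarith)
      exact ⟨u, hu, hs⟩
  have hc := env_cont hO hb h2 hm hf hl hW
  have hs := env_sub hO hm hf hl hW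
  have hP : PC Ω m lam (-A₁ / lam) f W := ⟨hc, hs, fun x hx => hW.1 _ hconst x hx⟩
  refine ⟨W, hc, hs, env_super hO hm hf hl hW hP, fun x hx => ?_⟩
  have u1 := hA lam hl hl1 W hc hs x hx
  have u2 := mul_le_mul_of_nonneg_left (hP.2.2 x hx) hl.le
  rw [mul_div_cancel₀ _ hl.ne'] at u2
  have := le_max_left |A| |A₁|
  have := le_max_right |A| |A₁|
  rw [abs_le]; constructor
  · linarith [le_abs_self A₁]
  · linarith [le_abs_self A]

theorem sol_iff {N : ℕ} {Ω : Set (Euc N)} (hO : IsOpen Ω) {m lam : ℝ} {f w : Euc N → ℝ} :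
    IsSCSolution Ω f lam m w ↔ ContinuousOn w (closure Ω) ∧
      HJSub Ω m (fun y => f y - lam * w y) w ∧ SCSuper Ω m lam f w := by
  unfold IsSCSolution HJSub SCSuper statOp
  refine and_congr Iff.rfl (and_congr ?_ ?_)
  · refine forall_congr' fun φ => forall_congr' fun _ => forall_congr' fun x => forall_congr' fun hx => ?_
    have : IsLocalMaxOn (w - φ) Ω x ↔ IsLocalMax (fun y => w y - φ y) x := by
      unfold IsLocalMaxOn IsLocalMax
      rw [hO.nhdsWithin_eq hx]; rfl
    rw [this]
    refine imp_congr Iff.rfl ⟨fun h => ?_, fun h => ?_⟩ <;> linarith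
  · refine forall_congr' fun φ => forall_congr' fun _ => forall_congr' fun x => forall_congr' fun hx => ?_
    have : IsLocalMinOn (w - φ) (closure Ω) x ↔ IsLocalMinOn (fun y => w y - φ y) (closure Ω) x := Iff.rfl
    rw [this]
    refine imp_congr Iff.rfl ⟨fun h => ?_, fun h => ?_⟩ <;> linarith

end SC

/-- Existence, uniqueness and uniform bound for the discounted
state-constraint problem, Lemma 3.5 of the paper. -/
theorem stmt10 {N : ℕ} (hN : 1 ≤ N) (Ω : Set (Euc N))
    (hΩo : IsOpen Ω) (hΩb : Bornology.IsBounded Ω) (hΩc : IsConnected Ω)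
    (hΩ2 : HasC2Boundary Ω)
    (m : ℝ) (hm : 2 < m) (f : Euc N → ℝ) (hf : ContinuousOn f (closure Ω)) :
    ∃ U : ℝ → Euc N → ℝ,
      (∀ lam : ℝ, 0 < lam → lam < 1 →
        IsSCSolution Ω f lam m (U lam) ∧
        ∀ v : Euc N → ℝ, IsSCSolution Ω f lam m v →
          Set.EqOn v (U lam) (closure Ω)) ∧
      ∃ C₁ > (0 : ℝ), ∀ lam : ℝ, 0 < lam → lam < 1 →
        ∀ x ∈ closure Ω, |lam * U lam x| ≤ C₁ := by
  obtain ⟨C, hC, hW⟩ := SC.perron hΩo hΩb hΩc.nonempty hΩ2 hm hf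
  choose! U h1 h2 h3 h4 using hW
  refine ⟨U, fun lam hl hl1 => ⟨(SC.sol_iff hΩo).mpr ⟨h1 lam hl hl1, h2 lam hl hl1, h3 lam hl hl1⟩,
    fun v hv x hx => ?_⟩, C, hC, fun lam hl hl1 x hx => h4 lam hl hl1 x hx⟩
  obtain ⟨v1, v2, v3⟩ := (SC.sol_iff hΩo).mp hv
  exact le_antisymm
    (SC.comparison hΩo hΩb hΩ2 hm hl hf v1 (h1 lam hl hl1) v2 (h3 lam hl hl1) x hx)
    (SC.comparison hΩo hΩb hΩ2 hm hl hf (h1 lam hl hl1) v1 (h2 lam hl hl1) v3 x hx)
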